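/- arXiv:1802.07843 — 10 statements merged into one kernel-verified Lean document; each statement's English description precedes it below -/
import Mathlib

section
/- Let n ≥ 1, let g ∈ ℝⁿ be a nonzero vector, let H be a symmetric n×n real matrix with operator norm ‖H‖ ≤ κ for some κ > 0, let f₀ ∈ ℝ, let γ > 0, and set δ := γ‖g‖. Define the quadratic model m(s) := f₀ + gᵀs + ½ sᵀH s. If s ∈ ℝⁿ satisfies ‖s‖ ≤ δ and m(s) ≤ m(−t g) for every t ≥ 0 with t‖g‖ ≤ δ (i.e., s does at least as well as the Cauchy point along the negative gradient direction), then m(0) − m(s) ≥ ½ · min{1/(1+κ), γ} · ‖g‖². -/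
open scoped RealInnerProductSpace

/-- Lemma 1, case `k ∈ K_g`: the Cauchy decrease along the negative gradient
direction with trust region radius `δ = γ‖g‖`. -/
theorem cauchy_decrease_grad_case
    (n : ℕ) (hn : 1 ≤ n)
    (g : EuclideanSpace ℝ (Fin n)) (hg : g ≠ 0)
    (H : EuclideanSpace ℝ (Fin n) →L[ℝ] EuclideanSpace ℝ (Fin n))
    (hHsym : ∀ u v : EuclideanSpace ℝ (Fin n), ⟪H u, v⟫ = ⟪u, H v⟫)
    (κ : ℝ) (hκ : 0 < κ) (hHnorm : ‖H‖ ≤ κ)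
    (f₀ : ℝ) (γ : ℝ) (hγ : 0 < γ)
    (δ : ℝ) (hδ : δ = γ * ‖g‖)
    (m : EuclideanSpace ℝ (Fin n) → ℝ)
    (hm : ∀ s, m s = f₀ + ⟪g, s⟫ + (1/2) * ⟪s, H s⟫)
    (s : EuclideanSpace ℝ (Fin n))
    (hs : ‖s‖ ≤ δ)
    (hcauchy : ∀ t : ℝ, 0 ≤ t → t * ‖g‖ ≤ δ → m s ≤ m (-(t • g))) :
    m 0 - m s ≥ (1/2) * min (1/(1+κ)) γ * ‖g‖^2 := by
  set t := min (1 / (1 + κ)) γ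
  have ht0 : 0 ≤ t := le_min (by positivity) hγ.le
  have htκ : t * κ ≤ 1 := by
    have h : t * (1 + κ) ≤ 1 := (le_div_iff₀ (by positivity)).mp (min_le_left _ _)
    linarith
  have hstep : m s ≤ m (-(t • g)) := by
    refine hcauchy t ht0 ?_
    rw [hδ]
    exact mul_le_mul_of_nonneg_right (min_le_right _ _) (norm_nonneg g)
  have hcurv : ⟪g, H g⟫ ≤ κ * ‖g‖ ^ 2 := calc
    ⟪g, H g⟫ ≤ ‖g‖ * ‖H g‖ := real_inner_le_norm _ _
    _ ≤ ‖g‖ * (κ * ‖g‖) := by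
      gcongr
      exact H.le_of_opNorm_le hHnorm g
    _ = κ * ‖g‖ ^ 2 := by ring
  have hmodel : m (-(t • g)) = f₀ - t * ‖g‖ ^ 2 + (1 / 2) * (t ^ 2 * ⟪g, H g⟫) := by
    rw [hm]
    simp only [map_neg, map_smul, inner_neg_left, inner_neg_right, inner_smul_left,
      inner_smul_right, real_inner_self_eq_norm_sq, conj_trivial]
    ring
  have hm0 : m 0 = f₀ := by simp [hm]
  have hquad : t ^ 2 * ⟪g, H g⟫ ≤ t * ‖g‖ ^ 2 := calc
    t ^ 2 * ⟪g, H g⟫ ≤ t ^ 2 * (κ * ‖g‖ ^ 2) := by gcongr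
    _ = (t * κ) * (t * ‖g‖ ^ 2) := by ring
    _ ≤ t * ‖g‖ ^ 2 := mul_le_of_le_one_left (by positivity) htκ
  linarith
end

section
/- Let n ≥ 1, let g ∈ ℝⁿ, let H be a symmetric n×n real matrix whose leftmost (smallest) eigenvalue λ satisfies λ < 0, let u be a unit eigenvector of H associated with λ satisfying gᵀu ≤ 0, let f₀ ∈ ℝ, let γ > 0, and set δ := γ|λ|. Define the quadratic model m(s) := f₀ + gᵀs + ½ sᵀH s. If s ∈ ℝⁿ satisfies ‖s‖ ≤ δ and m(s) ≤ m(t u) for every t with 0 ≤ t ≤ δ, then m(0) − m(s) ≥ ½ γ² |λ|³. -/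
open scoped RealInnerProductSpace

/-- Lemma 1, case `k ∈ K_H`: the Cauchy decrease along a leftmost eigenvector
direction with trust region radius `δ = γ|λ|`, where `λ < 0` is the leftmost
eigenvalue of the symmetric matrix `H`. -/
theorem cauchy_decrease_eig_case
    (n : ℕ) (hn : 1 ≤ n)
    (g : EuclideanSpace ℝ (Fin n))
    (H : EuclideanSpace ℝ (Fin n) →L[ℝ] EuclideanSpace ℝ (Fin n))
    (hHsym : ∀ u v : EuclideanSpace ℝ (Fin n), ⟪H u, v⟫ = ⟪u, H v⟫)
    (lam : ℝ) (hlam : lam < 0)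
    -- `lam` is the leftmost eigenvalue: it is an eigenvalue (with unit
    -- eigenvector `u`) and it bounds the Rayleigh quotient from below.
    (u : EuclideanSpace ℝ (Fin n)) (hu : ‖u‖ = 1) (heig : H u = lam • u)
    (hleft : ∀ v : EuclideanSpace ℝ (Fin n), ‖v‖ = 1 → lam ≤ ⟪v, H v⟫)
    (hgu : ⟪g, u⟫ ≤ 0)
    (f₀ : ℝ) (γ : ℝ) (hγ : 0 < γ)
    (δ : ℝ) (hδ : δ = γ * |lam|)
    (m : EuclideanSpace ℝ (Fin n) → ℝ)
    (hm : ∀ s, m s = f₀ + ⟪g, s⟫ + (1/2) * ⟪s, H s⟫)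
    (s : EuclideanSpace ℝ (Fin n))
    (hs : ‖s‖ ≤ δ)
    (hcauchy : ∀ t : ℝ, 0 ≤ t → t ≤ δ → m s ≤ m (t • u)) :
    m 0 - m s ≥ (1/2) * γ^2 * |lam|^3 := by
  have hδ0 : 0 ≤ δ := hδ ▸ mul_nonneg hγ.le (abs_nonneg lam)
  have hdec := hcauchy δ hδ0 le_rfl
  have hmu : m (δ • u) = f₀ + δ * ⟪g, u⟫ + (1/2) * (δ^2 * lam) := by
    rw [hm, map_smul, heig]
    simp only [real_inner_smul_left, real_inner_smul_right, real_inner_self_eq_norm_sq, hu]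
    ring
  have hm0 : m 0 = f₀ := by simp [hm]
  have hcurv : δ^2 * lam = -(γ^2 * |lam|^3) := by
    rw [hδ, abs_of_neg hlam]
    ring
  have hlin : δ * ⟪g, u⟫ ≤ 0 := mul_nonpos_of_nonneg_of_nonpos hδ0 hgu
  rw [hmu, hcurv] at hdec
  rw [hm0]
  linarith
end

section
/- Consider the trust region algorithm under the standing assumptions. Then for every k ∈ ℕ, γ_k ≥ γ_min, where γ_min := min{γ̲, γ_c/(1+κ), γ_c(1−η)/(2κ), 3γ_c(1−η)/L} ∈ (0, 1). -/
open scoped RealInnerProductSpace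

/-- A differentiable function with nonpositive derivative on `t ≥ 0` does not increase there. -/
theorem le_apply_zero_of_hasDerivAt_nonpos {F F' : ℝ → ℝ}
    (hF : ∀ t, HasDerivAt F (F' t) t) (hF' : ∀ t, 0 ≤ t → F' t ≤ 0) {t : ℝ} (ht : 0 ≤ t) :
    F t ≤ F 0 := by
  have hanti : AntitoneOn F (Set.Ici 0) := by
    refine antitoneOn_of_deriv_nonpos (convex_Ici 0)
      (fun t _ => (hF t).continuousAt.continuousWithinAt)
      (fun t _ => (hF t).differentiableAt.differentiableWithinAt) fun t ht => ?_
    rw [interior_Ici] at ht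
    rw [(hF t).deriv]
    exact hF' t (le_of_lt ht)
  exact hanti Set.self_mem_Ici ht ht

/-- Second-order Taylor upper bound when the second derivative is bounded by an affine function. -/
theorem taylor_upper_bound_of_second_deriv_le_affine {F F' F'' : ℝ → ℝ} {a b : ℝ}
    (hF : ∀ t, HasDerivAt F (F' t) t) (hF' : ∀ t, HasDerivAt F' (F'' t) t)
    (h : ∀ t, 0 ≤ t → F'' t ≤ a + b * t) :
    F 1 ≤ F 0 + F' 0 + a / 2 + b / 6 := by
  have hfirst : ∀ t, 0 ≤ t → F' t - F' 0 - a * t - b / 2 * t ^ 2 ≤ 0 := by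
    intro t ht
    have := le_apply_zero_of_hasDerivAt_nonpos
      (F := fun t => F' t - F' 0 - a * t - b / 2 * t ^ 2) (F' := fun t => F'' t - a - b * t)
      (fun t => by
        have := (((hF' t).sub_const (F' 0)).sub ((hasDerivAt_id t).const_mul a)).sub
          ((hasDerivAt_pow 2 t).const_mul (b / 2))
        exact this.congr_deriv (by push_cast; ring))
      (fun t ht => by linarith [h t ht]) ht
    simpa using this
  have := le_apply_zero_of_hasDerivAt_nonpos
    (F := fun t => F t - F' 0 * t - a / 2 * t ^ 2 - b / 6 * t ^ 3)
    (F' := fun t => F' t - F' 0 - a * t - b / 2 * t ^ 2)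
    (fun t => by
      have := (((hF t).sub ((hasDerivAt_id t).const_mul (F' 0))).sub
        ((hasDerivAt_pow 2 t).const_mul (a / 2))).sub ((hasDerivAt_pow 3 t).const_mul (b / 6))
      exact this.congr_deriv (by push_cast; ring))
    hfirst zero_le_one
  norm_num at this
  linarith

section Taylor

variable {E : Type*} [NormedAddCommGroup E] [InnerProductSpace ℝ E]

theorem abs_inner_clm_apply_self_le (A : E →L[ℝ] E) (s : E) :
    |⟪s, A s⟫| ≤ ‖A‖ * ‖s‖ ^ 2 := by
  have h₁ := abs_real_inner_le_norm s (A s)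
  have h₂ := mul_le_mul_of_nonneg_left (A.le_opNorm s) (norm_nonneg s)
  linarith

variable [CompleteSpace E] {f : E → ℝ} {g : E → E} {H : E → E →L[ℝ] E}

/-- Taylor upper bound along a segment on which the quadratic form of the Hessian is
bounded by an affine function. -/
theorem taylor_upper_bound_of_hessian_le_affine
    (hg : ∀ y, HasGradientAt f (g y) y) (hH : ∀ y, HasFDerivAt g (H y) y)
    (x s : E) {a b : ℝ} (h : ∀ t : ℝ, 0 ≤ t → ⟪s, H (x + t • s) s⟫ ≤ a + b * t) :
    f (x + s) ≤ f x + ⟪g x, s⟫ + a / 2 + b / 6 := by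
  have hline : ∀ t : ℝ, HasDerivAt (fun t : ℝ => x + t • s) s t := fun t => by
    simpa using ((hasDerivAt_id t).smul_const s).const_add x
  have := taylor_upper_bound_of_second_deriv_le_affine (F := fun t : ℝ => f (x + t • s))
    (F' := fun t => ⟪g (x + t • s), s⟫) (F'' := fun t => ⟪s, H (x + t • s) s⟫)
    (fun t => by
      simpa [Function.comp_def] using
        (hg (x + t • s)).hasFDerivAt.comp_hasDerivAt t (hline t))
    (fun t => by
      have := ((hH (x + t • s)).comp_hasDerivAt t (hline t)).inner ℝ (hasDerivAt_const t s)
      simpa [real_inner_comm] using this)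
    h
  simpa using this

theorem taylor_model_error_le_of_hessian_bounded
    (hg : ∀ y, HasGradientAt f (g y) y) (hH : ∀ y, HasFDerivAt g (H y) y)
    {κ : ℝ} (hκ : ∀ y, ‖H y‖ ≤ κ) (x s : E) :
    f (x + s) - (f x + ⟪g x, s⟫ + (1 / 2) * ⟪s, H x s⟫) ≤ κ * ‖s‖ ^ 2 := by
  have hquad : ∀ y, |⟪s, H y s⟫| ≤ κ * ‖s‖ ^ 2 := fun y =>
    (abs_inner_clm_apply_self_le (H y) s).trans
      (mul_le_mul_of_nonneg_right (hκ y) (sq_nonneg _))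
  have := taylor_upper_bound_of_hessian_le_affine hg hH x s (a := κ * ‖s‖ ^ 2) (b := 0)
    (fun t _ => by linarith [le_of_abs_le (hquad (x + t • s))])
  linarith [neg_le_of_abs_le (hquad x)]

theorem taylor_model_error_le_of_hessian_lipschitz
    (hg : ∀ y, HasGradientAt f (g y) y) (hH : ∀ y, HasFDerivAt g (H y) y)
    {L : ℝ} (hL : ∀ y z, ‖H y - H z‖ ≤ L * ‖y - z‖) (x s : E) :
    f (x + s) - (f x + ⟪g x, s⟫ + (1 / 2) * ⟪s, H x s⟫) ≤ L / 6 * ‖s‖ ^ 3 := by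
  have := taylor_upper_bound_of_hessian_le_affine hg hH x s (a := ⟪s, H x s⟫)
    (b := L * ‖s‖ ^ 3) (fun t ht => by
      have h₁ := le_of_abs_le (abs_inner_clm_apply_self_le (H (x + t • s) - H x) s)
      have h₂ := mul_le_mul_of_nonneg_right (hL (x + t • s) x) (sq_nonneg ‖s‖)
      rw [add_sub_cancel_left, norm_smul, Real.norm_of_nonneg ht] at h₂
      rw [_root_.sub_apply, inner_sub_right] at h₁
      linarith)
  linarith

end Taylor

/-- If the model error is at most `1 - η` times the (positive) predicted decrease, then the
acceptance ratio is at least `η`. -/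
theorem le_ratio_of_model_error_le {f₀ f₁ m₁ η : ℝ} (hpos : m₁ < f₀)
    (herr : f₁ - m₁ ≤ (1 - η) * (f₀ - m₁)) : η ≤ (f₀ - f₁) / (f₀ - m₁) := by
  rw [le_div_iff₀ (sub_pos.mpr hpos)]
  linarith

/-- Lemma 3 of the paper: the trust-region-radius control parameters `γ_k` are
uniformly bounded below by
`γ_min = min {γ̲, γ_c/(1+κ), γ_c(1-η)/(2κ), 3γ_c(1-η)/L} ∈ (0,1)`. -/
theorem gamma_uniform_lower_bound
    (n : ℕ) (hn : 1 ≤ n)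
    (f : EuclideanSpace ℝ (Fin n) → ℝ)
    (g : EuclideanSpace ℝ (Fin n) → EuclideanSpace ℝ (Fin n))
    (H : EuclideanSpace ℝ (Fin n) → EuclideanSpace ℝ (Fin n) →L[ℝ] EuclideanSpace ℝ (Fin n))
    (hf : ContDiff ℝ 2 f)
    (hg : ∀ y, HasGradientAt f (g y) y)
    (hH : ∀ y, HasFDerivAt g (H y) y)
    (finf : ℝ) (hfinf : ∀ y, finf ≤ f y)
    (L : ℝ) (hL : 0 < L)
    (hLip : ∀ y z : EuclideanSpace ℝ (Fin n), ‖H y - H z‖ ≤ L * ‖y - z‖)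
    (κ : ℝ) (hκ : 0 < κ) (hHnorm : ∀ y, ‖H y‖ ≤ κ)
    (γc η γlo γhi : ℝ)
    (hγc : γc ∈ Set.Ioo (0:ℝ) 1) (hη : η ∈ Set.Ioo (0:ℝ) 1)
    (hγlo : 0 < γlo) (hγlohi : γlo ≤ γhi)
    -- the iterates and associated quantities generated by the algorithm
    (x : ℕ → EuclideanSpace ℝ (Fin n)) (γ δ : ℕ → ℝ) (s : ℕ → EuclideanSpace ℝ (Fin n))
    (hγ0 : γ 0 ∈ Set.Icc γlo γhi)
    -- `lam k` is the leftmost eigenvalue of the Hessian at `x k`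
    (lam : ℕ → ℝ)
    (hlam : ∀ k, (∃ u : EuclideanSpace ℝ (Fin n), ‖u‖ = 1 ∧ H (x k) u = lam k • u) ∧
      ∀ v : EuclideanSpace ℝ (Fin n), ‖v‖ = 1 → lam k ≤ ⟪v, H (x k) v⟫)
    -- the quadratic models
    (m : ℕ → EuclideanSpace ℝ (Fin n) → ℝ)
    (hm : ∀ k s', m k s' = f (x k) + ⟪g (x k), s'⟫ + (1/2) * ⟪s', H (x k) s'⟫)
    -- each iteration is either in case `K_g` (the set `KG`) or in case `K_H`
    (KG : Set ℕ)
    (hKg : ∀ k ∈ KG, g (x k) ≠ 0 ∧ δ k = γ k * ‖g (x k)‖ ∧ ‖s k‖ ≤ δ k ∧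
      ∀ t : ℝ, 0 ≤ t → t * ‖g (x k)‖ ≤ δ k → m k (s k) ≤ m k (-(t • g (x k))))
    (hKH : ∀ k ∉ KG, lam k < 0 ∧ δ k = γ k * |min 0 (lam k)| ∧ ‖s k‖ ≤ δ k ∧
      ∃ u : EuclideanSpace ℝ (Fin n), ‖u‖ = 1 ∧ H (x k) u = lam k • u ∧ ⟪g (x k), u⟫ ≤ 0 ∧
        ∀ t : ℝ, 0 ≤ t → t ≤ δ k → m k (s k) ≤ m k (t • u))
    -- the acceptance ratio and the update of `x` and `γ`
    (ρ : ℕ → ℝ)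
    (hρ : ∀ k, ρ k = (f (x k) - f (x k + s k)) / (m k 0 - m k (s k)))
    (hsucc : ∀ k, η ≤ ρ k → x (k+1) = x k + s k ∧ γ (k+1) ∈ Set.Icc γlo γhi)
    (hfail : ∀ k, ρ k < η → x (k+1) = x k ∧ γ (k+1) = γc * γ k)
    -- the claimed lower bound
    (γmin : ℝ)
    (hγmin : γmin = min (min γlo (γc / (1 + κ))) (min (γc * (1 - η) / (2 * κ)) (3 * γc * (1 - η) / L))) :
    (0 < γmin ∧ γmin < 1) ∧ ∀ k : ℕ, γmin ≤ γ k := by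
  obtain ⟨hγc0, hγc1⟩ := hγc
  obtain ⟨hη0, hη1⟩ := hη
  have hη' : 0 < 1 - η := sub_pos.mpr hη1
  have hmin₁ : γmin ≤ γlo := by simp [hγmin]
  have hmin₂ : γmin ≤ γc / (1 + κ) := by simp [hγmin]
  have hmin₃ : γmin ≤ γc * (1 - η) / (2 * κ) := by simp [hγmin]
  have hmin₄ : γmin ≤ 3 * γc * (1 - η) / L := by simp [hγmin]
  have hpos : 0 < γmin := by
    rw [hγmin]
    refine lt_min (lt_min hγlo ?_) (lt_min ?_ ?_) <;> positivity
  refine ⟨⟨hpos, hmin₂.trans_lt ?_⟩, fun k => ?_⟩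
  · rw [div_lt_one (by positivity)]
    linarith
  induction k with
  | zero => exact hmin₁.trans hγ0.1
  | succ k ih =>
    rcases le_or_gt η (ρ k) with hk | hk
    · exact hmin₁.trans (hsucc k hk).2.1
    rw [(hfail k hk).2]
    by_contra! hlt
    have hγk : 0 < γ k := hpos.trans_le ih
    have hm0 : m k 0 = f (x k) := by simp [hm]
    refine hk.not_ge ?_
    rw [hρ, hm0]
    by_cases hK : k ∈ KG
    · obtain ⟨hg0, hδ, hs, hcauchy⟩ := hKg k hK
      have hγ₁ : γ k * (1 + κ) ≤ 1 := by
        have := hlt.trans_le hmin₂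
        rw [lt_div_iff₀ (by positivity)] at this
        nlinarith
      have hγ₂ : γ k * (2 * κ) ≤ 1 - η := by
        have := hlt.trans_le hmin₃
        rw [lt_div_iff₀ (by positivity)] at this
        nlinarith
      have hG : 0 < ‖g (x k)‖ := norm_pos_iff.mpr hg0
      have hdec : 1 / 2 * γ k * ‖g (x k)‖ ^ 2 ≤ f (x k) - m k (s k) := by
        have h₁ := hcauchy (γ k) hγk.le hδ.ge
        rw [hm k (-_)] at h₁
        simp only [map_neg, map_smul, inner_neg_left, inner_neg_right, inner_smul_left,
          inner_smul_right, real_inner_self_eq_norm_sq, conj_trivial] at h₁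
        have h₂ := (le_of_abs_le (abs_inner_clm_apply_self_le (H (x k)) (g (x k)))).trans
          (mul_le_mul_of_nonneg_right (hHnorm (x k)) (sq_nonneg _))
        have h₃ := mul_le_mul_of_nonneg_left h₂ (sq_nonneg (γ k))
        have h₄ : γ k * (γ k * κ) * ‖g (x k)‖ ^ 2 ≤ γ k * 1 * ‖g (x k)‖ ^ 2 := by
          gcongr
          linarith
        linarith
      refine le_ratio_of_model_error_le (sub_pos.mp (lt_of_lt_of_le (by positivity) hdec)) ?_
      have herr := taylor_model_error_le_of_hessian_bounded hg hH hHnorm (x k) (s k)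
      rw [← hm] at herr
      calc f (x k + s k) - m k (s k) ≤ κ * ‖s k‖ ^ 2 := herr
        _ ≤ κ * (γ k * ‖g (x k)‖) ^ 2 := by gcongr; exact hs.trans_eq hδ
        _ = γ k * (2 * κ) * (1 / 2 * γ k * ‖g (x k)‖ ^ 2) := by ring
        _ ≤ (1 - η) * (1 / 2 * γ k * ‖g (x k)‖ ^ 2) := by gcongr
        _ ≤ (1 - η) * (f (x k) - m k (s k)) := by gcongr
    · obtain ⟨hlam0, hδ, hs, u, hu, hHu, hgu, heig⟩ := hKH k hK
      rw [min_eq_right hlam0.le, abs_of_neg hlam0] at hδ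
      have hγ₁ : L * γ k ≤ 3 * (1 - η) := by
        have := hlt.trans_le hmin₄
        rw [lt_div_iff₀ hL] at this
        nlinarith
      have hδ0 : 0 < δ k := hδ ▸ mul_pos hγk (neg_pos.mpr hlam0)
      have hneg : 0 < -lam k := neg_pos.mpr hlam0
      have hdec : 1 / 2 * δ k ^ 2 * -lam k ≤ f (x k) - m k (s k) := by
        have h₁ := heig (δ k) hδ0.le le_rfl
        rw [hm k (_ • _)] at h₁
        simp only [map_smul, hHu, inner_smul_left, inner_smul_right, real_inner_self_eq_norm_sq,
          conj_trivial, hu] at h₁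
        have h₂ := mul_nonpos_of_nonneg_of_nonpos hδ0.le hgu
        linarith
      refine le_ratio_of_model_error_le (sub_pos.mp (lt_of_lt_of_le (by positivity) hdec)) ?_
      have herr := taylor_model_error_le_of_hessian_lipschitz hg hH hLip (x k) (s k)
      rw [← hm] at herr
      calc f (x k + s k) - m k (s k) ≤ L / 6 * ‖s k‖ ^ 3 := herr
        _ ≤ L / 6 * δ k ^ 3 := by gcongr
        _ = 1 / 6 * δ k ^ 2 * -lam k * (L * γ k) := by rw [pow_succ, hδ]; ring
        _ ≤ 1 / 6 * δ k ^ 2 * -lam k * (3 * (1 - η)) := by gcongr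
        _ = (1 - η) * (1 / 2 * δ k ^ 2 * -lam k) := by ring
        _ ≤ (1 - η) * (f (x k) - m k (s k)) := by gcongr
end

section
/- Consider the trust region algorithm under the standing assumptions, and set γ_min := min{γ̲, γ_c/(1+κ), γ_c(1−η)/(2κ), 3γ_c(1−η)/L} and κ_min := ½ η γ_min². Then for every successful iteration k ∈ S: if iteration k is in case K_g (δ_k = γ_k‖g_k‖), then f(x_k) − f(x_{k+1}) ≥ κ_min ‖g_k‖²; and if iteration k is in case K_H (δ_k = γ_k|(λ_k)₋|), then f(x_k) − f(x_{k+1}) ≥ κ_min |(λ_k)₋|³. -/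
open scoped RealInnerProductSpace

/-- A function with nonpositive derivative on `[0, 1]` stays below its value at `0`. -/
lemma le_value_zero_of_hasDerivAt_nonpos {p q : ℝ → ℝ} (hp : ∀ t, HasDerivAt p (q t) t)
    (hq : ∀ t ∈ Set.Icc (0 : ℝ) 1, q t ≤ 0) {t : ℝ} (ht : t ∈ Set.Icc (0 : ℝ) 1) :
    p t ≤ p 0 := by
  have hanti : AntitoneOn p (Set.Icc 0 1) := by
    refine antitoneOn_of_deriv_nonpos (convex_Icc 0 1)
      (fun y _ => (hp y).continuousAt.continuousWithinAt)
      (fun y _ => (hp y).differentiableAt.differentiableWithinAt) fun y hy => ?_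
    rw [(hp y).deriv]
    exact hq y (interior_subset hy)
  exact hanti ⟨le_rfl, zero_le_one⟩ ht ht.1

/-- One-variable Taylor upper bound when the second derivative is at most `A + B t`
on `[0, 1]`. -/
lemma taylor_upper_bound_of_second_deriv_le {p q r : ℝ → ℝ} {A B : ℝ}
    (hp : ∀ t, HasDerivAt p (q t) t) (hq : ∀ t, HasDerivAt q (r t) t)
    (hr : ∀ t ∈ Set.Icc (0 : ℝ) 1, r t ≤ A + B * t) :
    p 1 ≤ p 0 + q 0 + A / 2 + B / 6 := by
  have hq' : ∀ t ∈ Set.Icc (0 : ℝ) 1, q t - (q 0 + A * t + B / 2 * t ^ 2) ≤ 0 := by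
    intro t ht
    have h := le_value_zero_of_hasDerivAt_nonpos
      (p := fun t => q t - (q 0 + A * t + B / 2 * t ^ 2)) (q := fun t => r t - (A + B * t))
      (fun t => by
        have h1 := (((hasDerivAt_id t).const_mul A).const_add (q 0)).add
          (((hasDerivAt_id t).pow 2).const_mul (B / 2))
        refine ((hq t).sub h1).congr_deriv ?_
        simp
        ring)
      (fun t ht => by linarith [hr t ht]) ht
    simpa using h
  have h := le_value_zero_of_hasDerivAt_nonpos
    (p := fun t => p t - (q 0 * t + A / 2 * t ^ 2 + B / 6 * t ^ 3))
    (q := fun t => q t - (q 0 + A * t + B / 2 * t ^ 2))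
    (fun t => by
      have h1 := (((hasDerivAt_id t).const_mul (q 0)).add
        (((hasDerivAt_id t).pow 2).const_mul (A / 2))).add
        (((hasDerivAt_id t).pow 3).const_mul (B / 6))
      refine ((hp t).sub h1).congr_deriv ?_
      simp
      ring)
    hq' (t := 1) ⟨zero_le_one, le_rfl⟩
  norm_num at h
  linarith

section Taylor

variable {E : Type*} [NormedAddCommGroup E] [InnerProductSpace ℝ E]

lemma abs_inner_apply_le (T : E →L[ℝ] E) (v : E) : |⟪v, T v⟫| ≤ ‖T‖ * ‖v‖ ^ 2 := by
  calc |⟪v, T v⟫| ≤ ‖v‖ * ‖T v‖ := abs_real_inner_le_norm _ _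
    _ ≤ ‖v‖ * (‖T‖ * ‖v‖) := by gcongr; exact T.le_opNorm v
    _ = ‖T‖ * ‖v‖ ^ 2 := by ring

/-- Model decrease along the negative gradient for step sizes `t` with `t κ ≤ 1`. -/
lemma cauchy_step_model_le {κ t : ℝ} (T : E →L[ℝ] E) (hT : ‖T‖ ≤ κ) (ht : 0 ≤ t)
    (htκ : t * κ ≤ 1) (v : E) :
    ⟪v, -(t • v)⟫ + (1/2) * ⟪-(t • v), T (-(t • v))⟫ ≤ -(t / 2 * ‖v‖ ^ 2) := by
  have h1 : ⟪v, T v⟫ ≤ κ * ‖v‖ ^ 2 :=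
    (le_abs_self _).trans ((abs_inner_apply_le T v).trans (by gcongr))
  have h2 : t * (t * ⟪v, T v⟫) ≤ t * ‖v‖ ^ 2 := by
    refine mul_le_mul_of_nonneg_left ?_ ht
    calc t * ⟪v, T v⟫ ≤ t * (κ * ‖v‖ ^ 2) := mul_le_mul_of_nonneg_left h1 ht
      _ = t * κ * ‖v‖ ^ 2 := by ring
      _ ≤ 1 * ‖v‖ ^ 2 := by gcongr
      _ = ‖v‖ ^ 2 := one_mul _
  simp only [map_neg, map_smul, inner_neg_left, inner_neg_right, inner_smul_left,
    inner_smul_right, real_inner_self_eq_norm_sq, conj_trivial]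
  linarith

/-- Model decrease along a nonascent unit eigenvector. -/
lemma eigen_step_model_le {μ t : ℝ} (T : E →L[ℝ] E) {u v : E} (hu : ‖u‖ = 1)
    (hTu : T u = μ • u) (hvu : ⟪v, u⟫ ≤ 0) (ht : 0 ≤ t) :
    ⟪v, t • u⟫ + (1/2) * ⟪t • u, T (t • u)⟫ ≤ t ^ 2 * μ / 2 := by
  simp only [map_smul, hTu, inner_smul_left, inner_smul_right, real_inner_self_eq_norm_sq,
    conj_trivial, hu]
  nlinarith [mul_nonpos_of_nonneg_of_nonpos ht hvu]

variable [CompleteSpace E] {f : E → ℝ} {g : E → E} {H : E → E →L[ℝ] E}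

/-- Taylor upper bound along the segment from `x` to `x + s`. -/
lemma taylor_upper_bound_of_hessian_le (hg : ∀ y, HasGradientAt f (g y) y)
    (hH : ∀ y, HasFDerivAt g (H y) y) (x s : E) {A B : ℝ}
    (hAB : ∀ t ∈ Set.Icc (0 : ℝ) 1, ⟪s, H (x + t • s) s⟫ ≤ A + B * t) :
    f (x + s) ≤ f x + ⟪g x, s⟫ + A / 2 + B / 6 := by
  have hline : ∀ t : ℝ, HasDerivAt (fun t : ℝ => x + t • s) s t := fun t => by
    simpa using ((hasDerivAt_id t).smul_const s).const_add x
  have h := taylor_upper_bound_of_second_deriv_le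
    (p := fun t => f (x + t • s)) (q := fun t => ⟪s, g (x + t • s)⟫)
    (r := fun t => ⟪s, H (x + t • s) s⟫)
    (fun t => by
      refine ((hg (x + t • s)).hasFDerivAt.comp_hasDerivAt t (hline t)).congr_deriv ?_
      simp [real_inner_comm])
    (fun t => by
      simpa using (hasDerivAt_const t s).inner ℝ
        ((hH (x + t • s)).comp_hasDerivAt t (hline t))) hAB
  simpa [real_inner_comm] using h

/-- The quadratic model underestimates `f` by at most `κ ‖s‖²` when `‖H‖ ≤ κ`. -/
lemma le_model_add_of_hessian_norm_le (hg : ∀ y, HasGradientAt f (g y) y)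
    (hH : ∀ y, HasFDerivAt g (H y) y) {κ : ℝ} (hκ : ∀ y, ‖H y‖ ≤ κ) (x s : E) :
    f (x + s) ≤ f x + ⟪g x, s⟫ + (1/2) * ⟪s, H x s⟫ + κ * ‖s‖ ^ 2 := by
  have hb : ∀ y, |⟪s, H y s⟫| ≤ κ * ‖s‖ ^ 2 := fun y =>
    (abs_inner_apply_le _ _).trans (by gcongr; exact hκ y)
  have h := taylor_upper_bound_of_hessian_le hg hH x s (A := κ * ‖s‖ ^ 2) (B := 0)
    fun t _ => by linarith [(abs_le.mp (hb (x + t • s))).2]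
  linarith [(abs_le.mp (hb x)).1]

/-- The quadratic model underestimates `f` by at most `L / 6 ‖s‖³` when the Hessian is
`L`-Lipschitz. -/
lemma le_model_add_of_hessian_lipschitz (hg : ∀ y, HasGradientAt f (g y) y)
    (hH : ∀ y, HasFDerivAt g (H y) y) {L : ℝ}
    (hLip : ∀ y z, ‖H y - H z‖ ≤ L * ‖y - z‖) (x s : E) :
    f (x + s) ≤ f x + ⟪g x, s⟫ + (1/2) * ⟪s, H x s⟫ + L / 6 * ‖s‖ ^ 3 := by
  have h := taylor_upper_bound_of_hessian_le hg hH x s (A := ⟪s, H x s⟫) (B := L * ‖s‖ ^ 3)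
    fun t ht => by
      have h1 := (abs_le.mp (abs_inner_apply_le (H (x + t • s) - H x) s)).2
      have h2 := hLip (x + t • s) x
      rw [add_sub_cancel_left, norm_smul, Real.norm_of_nonneg ht.1] at h2
      have h3 := mul_le_mul_of_nonneg_right h2 (sq_nonneg ‖s‖)
      rw [sub_apply, inner_sub_right] at h1
      linarith
  linarith

end Taylor

/-- Inequality (f-dec) of Lemma 4 of the paper: on every successful iteration
the objective decreases by at least `κ_min ‖g_k‖²` (case `K_g`) or
`κ_min |(λ_k)₋|³` (case `K_H`), where `κ_min = ½ η γ_min²`. -/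
theorem successful_iteration_decrease
    (n : ℕ) (hn : 1 ≤ n)
    (f : EuclideanSpace ℝ (Fin n) → ℝ)
    (g : EuclideanSpace ℝ (Fin n) → EuclideanSpace ℝ (Fin n))
    (H : EuclideanSpace ℝ (Fin n) → EuclideanSpace ℝ (Fin n) →L[ℝ] EuclideanSpace ℝ (Fin n))
    (hf : ContDiff ℝ 2 f)
    (hg : ∀ y, HasGradientAt f (g y) y)
    (hH : ∀ y, HasFDerivAt g (H y) y)
    (finf : ℝ) (hfinf : ∀ y, finf ≤ f y)
    (L : ℝ) (hL : 0 < L)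
    (hLip : ∀ y z : EuclideanSpace ℝ (Fin n), ‖H y - H z‖ ≤ L * ‖y - z‖)
    (κ : ℝ) (hκ : 0 < κ) (hHnorm : ∀ y, ‖H y‖ ≤ κ)
    (γc η γlo γhi : ℝ)
    (hγc : γc ∈ Set.Ioo (0:ℝ) 1) (hη : η ∈ Set.Ioo (0:ℝ) 1)
    (hγlo : 0 < γlo) (hγlohi : γlo ≤ γhi)
    -- the iterates and associated quantities generated by the algorithm
    (x : ℕ → EuclideanSpace ℝ (Fin n)) (γ δ : ℕ → ℝ) (s : ℕ → EuclideanSpace ℝ (Fin n))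
    (hγ0 : γ 0 ∈ Set.Icc γlo γhi)
    -- `lam k` is the leftmost eigenvalue of the Hessian at `x k`
    (lam : ℕ → ℝ)
    (hlam : ∀ k, (∃ u : EuclideanSpace ℝ (Fin n), ‖u‖ = 1 ∧ H (x k) u = lam k • u) ∧
      ∀ v : EuclideanSpace ℝ (Fin n), ‖v‖ = 1 → lam k ≤ ⟪v, H (x k) v⟫)
    -- the quadratic models
    (m : ℕ → EuclideanSpace ℝ (Fin n) → ℝ)
    (hm : ∀ k s', m k s' = f (x k) + ⟪g (x k), s'⟫ + (1/2) * ⟪s', H (x k) s'⟫)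
    -- each iteration is either in case `K_g` (the set `KG`) or in case `K_H`
    (KG : Set ℕ)
    (hKg : ∀ k ∈ KG, g (x k) ≠ 0 ∧ δ k = γ k * ‖g (x k)‖ ∧ ‖s k‖ ≤ δ k ∧
      ∀ t : ℝ, 0 ≤ t → t * ‖g (x k)‖ ≤ δ k → m k (s k) ≤ m k (-(t • g (x k))))
    (hKH : ∀ k ∉ KG, lam k < 0 ∧ δ k = γ k * |min 0 (lam k)| ∧ ‖s k‖ ≤ δ k ∧
      ∃ u : EuclideanSpace ℝ (Fin n), ‖u‖ = 1 ∧ H (x k) u = lam k • u ∧ ⟪g (x k), u⟫ ≤ 0 ∧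
        ∀ t : ℝ, 0 ≤ t → t ≤ δ k → m k (s k) ≤ m k (t • u))
    -- the acceptance ratio and the update of `x` and `γ`
    (ρ : ℕ → ℝ)
    (hρ : ∀ k, ρ k = (f (x k) - f (x k + s k)) / (m k 0 - m k (s k)))
    (hsucc : ∀ k, η ≤ ρ k → x (k+1) = x k + s k ∧ γ (k+1) ∈ Set.Icc γlo γhi)
    (hfail : ∀ k, ρ k < η → x (k+1) = x k ∧ γ (k+1) = γc * γ k)
    -- the claimed lower bound
    (γmin : ℝ)
    (hγmin : γmin = min (min γlo (γc / (1 + κ))) (min (γc * (1 - η) / (2 * κ)) (3 * γc * (1 - η) / L)))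
    (κmin : ℝ) (hκmin : κmin = (1/2) * η * γmin^2) :
    ∀ k : ℕ, η ≤ ρ k →
      (k ∈ KG → f (x k) - f (x (k+1)) ≥ κmin * ‖g (x k)‖^2) ∧
      (k ∉ KG → f (x k) - f (x (k+1)) ≥ κmin * |min 0 (lam k)|^3) := by
  have hγc0 := hγc.1
  have hη0 := hη.1
  have hη1 : 0 < 1 - η := sub_pos.mpr hη.2
  have hκ1 : 0 < 1 + κ := by linarith
  have hγmin0 : 0 < γmin := by
    rw [hγmin]
    positivity
  have hmin_lo : γmin ≤ γlo := hγmin ▸ (min_le_left _ _).trans (min_le_left _ _)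
  have hmin_cauchy : γmin ≤ γc * (1 / (1 + κ)) := by
    rw [mul_one_div, hγmin]
    exact (min_le_left _ _).trans (min_le_right _ _)
  have hmin_κ : γmin ≤ γc * ((1 - η) / (2 * κ)) := by
    rw [← mul_div_assoc, hγmin]
    exact (min_le_right _ _).trans (min_le_left _ _)
  have hmin_L : γmin ≤ γc * (3 * (1 - η) / L) := by
    rw [← mul_div_assoc, hγmin]
    refine (min_le_right _ _).trans ((min_le_right _ _).trans_eq ?_)
    ring
  have hinv0 : 0 < 1 / (1 + κ) := by positivity
  have hmin_inv : γmin ≤ 1 / (1 + κ) :=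
    hmin_cauchy.trans (mul_le_of_le_one_left hinv0.le hγc.2.le)
  have hmin_one : γmin ≤ 1 :=
    hmin_inv.trans ((div_le_one hκ1).mpr (by linarith))
  have hm0 : ∀ k, m k 0 = f (x k) := fun k => by simp [hm]
  -- decrease of the model in the two cases
  have hdecG : ∀ k ∈ KG, ∀ t, 0 ≤ t → t ≤ γ k → t ≤ 1 / (1 + κ) →
      t / 2 * ‖g (x k)‖ ^ 2 ≤ m k 0 - m k (s k) := by
    intro k hk t ht htγ htκ
    obtain ⟨-, hδ, -, hbest⟩ := hKg k hk
    have h1 := hbest t ht (by rw [hδ]; gcongr)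
    have htκ' : t * κ ≤ 1 := by
      have := (le_div_iff₀ hκ1).mp htκ
      linarith
    have h2 := cauchy_step_model_le (H (x k)) (hHnorm _) ht htκ' (g (x k))
    rw [hm k (-(t • _))] at h1
    rw [hm0]
    linarith
  have hdecH : ∀ k ∉ KG, 0 < γ k →
      γ k ^ 2 / 2 * |min 0 (lam k)| ^ 3 ≤ m k 0 - m k (s k) := by
    intro k hk hγ
    obtain ⟨hneg, hδ, -, u, hu, hHu, hgu, hbest⟩ := hKH k hk
    have hδ0 : 0 ≤ δ k := by rw [hδ]; positivity
    have h1 := hbest (δ k) hδ0 le_rfl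
    have h2 := eigen_step_model_le (H (x k)) hu hHu hgu hδ0
    rw [hm k (δ k • u)] at h1
    rw [hm0]
    rw [hδ, min_eq_right hneg.le, abs_of_neg hneg] at *
    linarith
  -- unsuccessful iterations have a large `γ k`
  have hlarge : ∀ k, 0 < γ k → ρ k < η → γmin ≤ γc * γ k := by
    intro k hγ hfailed
    by_contra! hlt
    have hsmall : ∀ c, γmin ≤ γc * c → γ k ≤ c := fun c hc =>
      (lt_of_mul_lt_mul_left (hlt.trans_le hc) hγc0.le).le
    have hγinv := hsmall _ hmin_cauchy
    have hγκ := (le_div_iff₀ (by positivity)).mp (hsmall _ hmin_κ)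
    have hγL := (le_div_iff₀ hL).mp (hsmall _ hmin_L)
    -- a model error of at most `(1 - η)` times the model decrease forces success
    have key : ∀ D e, 0 < D → D ≤ m k 0 - m k (s k) → e ≤ (1 - η) * D →
        f (x k + s k) ≤ m k (s k) + e → False := by
      intro D e hD hDm he hfe
      refine hfailed.not_ge ?_
      rw [hρ, le_div_iff₀ (hD.trans_le hDm)]
      have := mul_le_mul_of_nonneg_left hDm hη1.le
      linarith [hm0 k]
    by_cases hk : k ∈ KG
    · obtain ⟨hg0, hδ, hs, -⟩ := hKg k hk
      have hgpos : 0 < ‖g (x k)‖ := norm_pos_iff.mpr hg0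
      refine key _ (κ * ‖s k‖ ^ 2) (by positivity) (hdecG k hk (γ k) hγ.le le_rfl hγinv) ?_ ?_
      · calc κ * ‖s k‖ ^ 2 ≤ κ * (γ k * ‖g (x k)‖) ^ 2 := by rw [← hδ]; gcongr
          _ = γ k * (2 * κ) * (γ k / 2 * ‖g (x k)‖ ^ 2) := by ring
          _ ≤ _ := by gcongr
      · rw [hm]
        exact le_model_add_of_hessian_norm_le hg hH hHnorm _ _
    · obtain ⟨hneg, hδ, hs, -⟩ := hKH k hk
      have hlampos : 0 < |min 0 (lam k)| := abs_pos.mpr (by rw [min_eq_right hneg.le]; exact hneg.ne)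
      refine key _ (L / 6 * ‖s k‖ ^ 3) (by positivity) (hdecH k hk hγ) ?_ ?_
      · calc L / 6 * ‖s k‖ ^ 3 ≤ L / 6 * (γ k * |min 0 (lam k)|) ^ 3 := by rw [← hδ]; gcongr
          _ = γ k * L / 3 * (γ k ^ 2 / 2 * |min 0 (lam k)| ^ 3) := by ring
          _ ≤ _ := by gcongr; linarith
      · rw [hm]
        exact le_model_add_of_hessian_lipschitz hg hH hLip _ _
  have hγk : ∀ k, γmin ≤ γ k := by
    intro k
    induction k with
    | zero => exact hmin_lo.trans hγ0.1
    | succ k ih =>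
      rcases le_or_gt η (ρ k) with h | h
      · exact hmin_lo.trans (hsucc k h).2.1
      · rw [(hfail k h).2]
        exact hlarge k (hγmin0.trans_le ih) h
  intro k hk
  rw [(hsucc k hk).1]
  -- sufficient decrease of the model passes to the objective on a successful iteration
  have htransfer : ∀ D, 0 < D → D ≤ m k 0 - m k (s k) → η * D ≤ f (x k) - f (x k + s k) := by
    intro D hD hDm
    rw [hρ, le_div_iff₀ (hD.trans_le hDm)] at hk
    exact (mul_le_mul_of_nonneg_left hDm hη0.le).trans hk
  refine ⟨fun hkG => ?_, fun hkG => ?_⟩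
  · have hgpos : 0 < ‖g (x k)‖ := norm_pos_iff.mpr (hKg k hkG).1
    refine le_trans ?_ (htransfer _ (by positivity)
      (hdecG k hkG γmin hγmin0.le (hγk k) hmin_inv))
    rw [hκmin, show η * (γmin / 2 * ‖g (x k)‖ ^ 2) = 1 / 2 * η * γmin * ‖g (x k)‖ ^ 2 by ring]
    gcongr
    exact pow_le_of_le_one hγmin0.le hmin_one two_ne_zero
  · have hneg := (hKH k hkG).1
    have hγ := hγmin0.trans_le (hγk k)
    have hlampos : 0 < |min 0 (lam k)| := abs_pos.mpr (by rw [min_eq_right hneg.le]; exact hneg.ne)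
    refine le_trans ?_ (htransfer _ (by positivity) (hdecH k hkG hγ))
    rw [hκmin, show η * (γ k ^ 2 / 2 * |min 0 (lam k)| ^ 3)
      = 1 / 2 * η * γ k ^ 2 * |min 0 (lam k)| ^ 3 by ring]
    gcongr
    exact hγk k
end

section
/- Let γ_c ∈ (0,1), 0 < γ_min ≤ γ̄ < ∞, and let (γ_k) be a real sequence with γ_k ≤ γ̄ and γ_k ≥ γ_min for all k ∈ ℕ. Suppose that for some k ∈ ℕ and N ∈ ℕ, every index j with k ≤ j < k + N satisfies γ_{j+1} = γ_c γ_j (i.e., iterations k, k+1, …, k+N−1 are all unsuccessful). Then N ≤ ⌈log(γ_min/γ̄)/log(γ_c)⌉, i.e., the number of consecutive unsuccessful iterations is at most ⌈log_{γ_c}(γ_min/γ̄)⌉. -/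
/-- A sequence obeying `u (j + 1) = c * u j` on `[k, k + N)` satisfies `u (k + N) = c ^ N * u k`. -/
theorem eq_pow_mul_of_consecutive {M : Type*} [Monoid M] {c : M} {u : ℕ → M} {k : ℕ} (N : ℕ)
    (h : ∀ j : ℕ, k ≤ j → j < k + N → u (j + 1) = c * u j) :
    u (k + N) = c ^ N * u k := by
  induction N with
  | zero => simp
  | succ n ih =>
    rw [← add_assoc, h (k + n) (by omega) (by omega),
      ih fun j hj hjn => h j hj (by omega), pow_succ', mul_assoc]

/-- Lemma 5 of the paper: if `γ_{j+1} = γ_c γ_j` on `N` consecutive iterations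
while `γ_j` always remains in `[γ_min, γ̄]`, then
`N ≤ ⌈log(γ_min/γ̄)/log(γ_c)⌉`. -/
theorem consecutive_unsuccessful_bound
    (γc γmin γhi : ℝ)
    (hγc : γc ∈ Set.Ioo (0:ℝ) 1)
    (hγmin : 0 < γmin) (hγminhi : γmin ≤ γhi)
    (γ : ℕ → ℝ)
    (hub : ∀ k : ℕ, γ k ≤ γhi)
    (hlb : ∀ k : ℕ, γmin ≤ γ k)
    (k N : ℕ)
    (hconsec : ∀ j : ℕ, k ≤ j → j < k + N → γ (j+1) = γc * γ j) :
    N ≤ ⌈Real.log (γmin / γhi) / Real.log γc⌉₊ := by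
  obtain ⟨hc0, hc1⟩ := hγc
  have hhi : 0 < γhi := hγmin.trans_le hγminhi
  have hle : γmin / γhi ≤ γc ^ N := by
    rw [div_le_iff₀ hhi]
    calc γmin ≤ γ (k + N) := hlb _
      _ = γc ^ N * γ k := eq_pow_mul_of_consecutive N hconsec
      _ ≤ γc ^ N * γhi := by gcongr; exact hub k
  have hlog := Real.log_le_log (div_pos hγmin hhi) hle
  rw [Real.log_pow] at hlog
  have hN : (N : ℝ) ≤ Real.log (γmin / γhi) / Real.log γc :=
    (le_div_iff_of_neg (Real.log_neg hc0 hc1)).2 hlog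
  exact_mod_cast hN.trans (Nat.le_ceil _)
end

section
/- Consider the trust region algorithm under the standing assumptions with Update 1, i.e., with δ_k = γ_k‖g_k‖ (and Cauchy condition along −g_k) at every iteration k, and suppose g_k ≠ 0 for all k. Set γ_min := min{γ̲, γ_c/(1+κ), γ_c(1−η)/(2κ), 3γ_c(1−η)/L} and κ_min := ½ η γ_min². Then for any ε > 0, the set S₁(ε) := {k ∈ S : ‖g_k‖ > ε} of successful iterations with gradient norm exceeding ε is finite and its cardinality satisfies |S₁(ε)| ≤ ⌊(f(x₀) − f_inf)/(κ_min ε²)⌋. -/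
open scoped RealInnerProductSpace

section TrustRegion

variable {E : Type*} [NormedAddCommGroup E] [InnerProductSpace ℝ E]

theorem inner_clm_self_le_of_norm_le {A : E →L[ℝ] E} {κ : ℝ} (hA : ‖A‖ ≤ κ) (v : E) :
    |⟪v, A v⟫| ≤ κ * ‖v‖ ^ 2 :=
  calc |⟪v, A v⟫| ≤ ‖v‖ * ‖A v‖ := abs_real_inner_le_norm v (A v)
    _ ≤ ‖v‖ * (κ * ‖v‖) := by gcongr; exact A.le_of_opNorm_le hA v
    _ = κ * ‖v‖ ^ 2 := by ring

/-- The descent lemma for a function whose Hessian is bounded by `κ`. -/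
theorem image_add_le_of_norm_hessian_le [CompleteSpace E] {f : E → ℝ} {g : E → E}
    {H : E → E →L[ℝ] E} {κ : ℝ} (hg : ∀ y, HasGradientAt f (g y) y)
    (hH : ∀ y, HasFDerivAt g (H y) y) (hHnorm : ∀ y, ‖H y‖ ≤ κ) (x s : E) :
    f (x + s) ≤ f x + ⟪g x, s⟫ + κ / 2 * ‖s‖ ^ 2 := by
  have hgLip : ∀ y z, ‖g z - g y‖ ≤ κ * ‖z - y‖ := fun y z ↦
    convex_univ.norm_image_sub_le_of_norm_hasFDerivWithin_le
      (fun w _ ↦ (hH w).hasFDerivWithinAt) (fun w _ ↦ hHnorm w) (Set.mem_univ y) (Set.mem_univ z)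
  let φ : ℝ → ℝ := fun t ↦ f (x + t • s) - t * ⟪g x, s⟫ - κ / 2 * ‖s‖ ^ 2 * t ^ 2
  have hφ : ∀ t, HasDerivAt φ (⟪g (x + t • s), s⟫ - ⟪g x, s⟫ - κ * ‖s‖ ^ 2 * t) t := by
    intro t
    have hline : HasDerivAt (fun t : ℝ ↦ x + t • s) s t := by
      simpa using ((hasDerivAt_id t).smul_const s).const_add x
    have hcomp : HasDerivAt (fun t : ℝ ↦ f (x + t • s)) ⟪g (x + t • s), s⟫ t :=
      ((hg (x + t • s)).hasFDerivAt.comp_hasDerivAt t hline).congr_deriv (by simp)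
    have hsq := ((hasDerivAt_pow 2 t).const_mul (κ / 2 * ‖s‖ ^ 2))
    refine ((hcomp.sub ((hasDerivAt_id t).mul_const ⟪g x, s⟫)).sub hsq).congr_deriv ?_
    push_cast
    ring
  have hanti : AntitoneOn φ (Set.Icc 0 1) := by
    refine antitoneOn_of_hasDerivWithinAt_nonpos (convex_Icc 0 1)
      (fun t _ ↦ (hφ t).continuousAt.continuousWithinAt)
      (fun t _ ↦ (hφ t).hasDerivWithinAt) fun t ht ↦ ?_
    rw [interior_Icc] at ht
    have hle : ⟪g (x + t • s) - g x, s⟫ ≤ κ * ‖s‖ ^ 2 * t :=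
      calc ⟪g (x + t • s) - g x, s⟫ ≤ ‖g (x + t • s) - g x‖ * ‖s‖ := real_inner_le_norm _ _
        _ ≤ (κ * ‖x + t • s - x‖) * ‖s‖ := by gcongr; exact hgLip _ _
        _ = κ * ‖s‖ ^ 2 * t := by
          rw [add_sub_cancel_left, norm_smul, Real.norm_of_nonneg ht.1.le]
          ring
    rw [inner_sub_left] at hle
    linarith
  have h01 := hanti (Set.left_mem_Icc.2 zero_le_one) (Set.right_mem_Icc.2 zero_le_one) zero_le_one
  simp only [φ, one_smul, zero_smul, add_zero] at h01
  linarith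

/-- The decrease of a quadratic model along the negative gradient. -/
theorem half_mul_norm_sq_le_neg_quadratic {A : E →L[ℝ] E} {κ t : ℝ} (hA : ‖A‖ ≤ κ)
    (ht : 0 ≤ t) (htκ : t * κ ≤ 1) (v : E) :
    t / 2 * ‖v‖ ^ 2 ≤ -(⟪v, -(t • v)⟫ + 1 / 2 * ⟪-(t • v), A (-(t • v))⟫) := by
  have hv := (abs_le.1 (inner_clm_self_le_of_norm_le hA v)).2
  have hquad : t ^ 2 * ⟪v, A v⟫ ≤ t * ‖v‖ ^ 2 :=
    calc t ^ 2 * ⟪v, A v⟫ ≤ t ^ 2 * (κ * ‖v‖ ^ 2) := by gcongr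
      _ = t * κ * (t * ‖v‖ ^ 2) := by ring
      _ ≤ 1 * (t * ‖v‖ ^ 2) := by gcongr
      _ = t * ‖v‖ ^ 2 := one_mul _
  simp only [map_neg, map_smul, inner_neg_left, inner_neg_right, real_inner_smul_left,
    real_inner_smul_right, real_inner_self_eq_norm_sq]
  nlinarith

end TrustRegion

/-- If a sequence that is bounded below never increases and drops by at least `c > 0` at every
index of `S`, then `S` is finite, with an explicit bound on its cardinality. -/
theorem finite_and_ncard_le_floor_of_decrease {a : ℕ → ℝ} {b c : ℝ} {S : Set ℕ} (hc : 0 < c)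
    (hb : ∀ k, b ≤ a k) (ha : ∀ k, a (k + 1) ≤ a k) (hS : ∀ k ∈ S, a (k + 1) + c ≤ a k) :
    S.Finite ∧ S.ncard ≤ ⌊(a 0 - b) / c⌋₊ := by
  classical
  have hcount : ∀ N : ℕ, a N + c * ((Finset.range N).filter (· ∈ S)).card ≤ a 0 := by
    intro N
    induction N with
    | zero => simp
    | succ N ih =>
      rw [Finset.range_add_one, Finset.filter_insert]
      split_ifs with hN
      · rw [Finset.card_insert_of_notMem (by simp)]
        push_cast
        linarith [hS N hN]
      · linarith [ha N]
  have hcard : ∀ T : Finset ℕ, ↑T ⊆ S → T.card ≤ ⌊(a 0 - b) / c⌋₊ := by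
    intro T hT
    obtain ⟨N, hN⟩ := T.exists_nat_subset_range
    have hsub : T ⊆ (Finset.range N).filter (· ∈ S) := fun k hk ↦
      Finset.mem_filter.2 ⟨hN hk, hT hk⟩
    refine (Finset.card_le_card hsub).trans (Nat.le_floor ?_)
    rw [le_div_iff₀ hc]
    linarith [hcount N, hb N]
  have hfin : S.Finite := by
    by_contra hinf
    obtain ⟨T, hT, hTcard⟩ :=
      Set.Infinite.exists_subset_card_eq hinf (⌊(a 0 - b) / c⌋₊ + 1)
    have := hcard T hT
    omega
  refine ⟨hfin, ?_⟩
  rw [Set.ncard_eq_toFinset_card S hfin]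
  exact hcard _ (by simp)

/-- Lemma 6 of the paper: under Update 1 (`δ_k = γ_k‖g_k‖` at every iteration),
the number of successful iterations with `‖g_k‖ > ε` is at most
`⌊(f(x₀) − f_inf)/(κ_min ε²)⌋`. -/
theorem successful_iterations_bound_first_order
    (n : ℕ) (hn : 1 ≤ n)
    (f : EuclideanSpace ℝ (Fin n) → ℝ)
    (g : EuclideanSpace ℝ (Fin n) → EuclideanSpace ℝ (Fin n))
    (H : EuclideanSpace ℝ (Fin n) → EuclideanSpace ℝ (Fin n) →L[ℝ] EuclideanSpace ℝ (Fin n))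
    (hf : ContDiff ℝ 2 f)
    (hg : ∀ y, HasGradientAt f (g y) y)
    (hH : ∀ y, HasFDerivAt g (H y) y)
    (finf : ℝ) (hfinf : ∀ y, finf ≤ f y)
    (L : ℝ) (hL : 0 < L)
    (hLip : ∀ y z : EuclideanSpace ℝ (Fin n), ‖H y - H z‖ ≤ L * ‖y - z‖)
    (κ : ℝ) (hκ : 0 < κ) (hHnorm : ∀ y, ‖H y‖ ≤ κ)
    (γc η γlo γhi : ℝ)
    (hγc : γc ∈ Set.Ioo (0:ℝ) 1) (hη : η ∈ Set.Ioo (0:ℝ) 1)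
    (hγlo : 0 < γlo) (hγlohi : γlo ≤ γhi)
    (x : ℕ → EuclideanSpace ℝ (Fin n)) (γ δ : ℕ → ℝ) (s : ℕ → EuclideanSpace ℝ (Fin n))
    (hγ0 : γ 0 ∈ Set.Icc γlo γhi)
    (m : ℕ → EuclideanSpace ℝ (Fin n) → ℝ)
    (hm : ∀ k s', m k s' = f (x k) + ⟪g (x k), s'⟫ + (1/2) * ⟪s', H (x k) s'⟫)
    -- Update 1: every iteration is in case `K_g`
    (hgk : ∀ k : ℕ, g (x k) ≠ 0)
    (halg : ∀ k : ℕ, δ k = γ k * ‖g (x k)‖ ∧ ‖s k‖ ≤ δ k ∧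
      ∀ t : ℝ, 0 ≤ t → t * ‖g (x k)‖ ≤ δ k → m k (s k) ≤ m k (-(t • g (x k))))
    (ρ : ℕ → ℝ)
    (hρ : ∀ k, ρ k = (f (x k) - f (x k + s k)) / (m k 0 - m k (s k)))
    (hsucc : ∀ k, η ≤ ρ k → x (k+1) = x k + s k ∧ γ (k+1) ∈ Set.Icc γlo γhi)
    (hfail : ∀ k, ρ k < η → x (k+1) = x k ∧ γ (k+1) = γc * γ k)
    (γmin κmin : ℝ)
    (hγmin : γmin = min (min γlo (γc / (1 + κ))) (min (γc * (1 - η) / (2 * κ)) (3 * γc * (1 - η) / L)))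
    (hκmin : κmin = (1/2) * η * γmin^2) :
    ∀ ε : ℝ, 0 < ε →
      {k : ℕ | η ≤ ρ k ∧ ε < ‖g (x k)‖}.Finite ∧
      {k : ℕ | η ≤ ρ k ∧ ε < ‖g (x k)‖}.ncard ≤ ⌊(f (x 0) - finf) / (κmin * ε^2)⌋₊ := by
  intro ε hε
  obtain ⟨hγc0, hγc1⟩ := hγc
  obtain ⟨hη0, hη1⟩ := hη
  have hη1' : 0 < 1 - η := by linarith
  have hγmin0 : 0 < γmin := by
    rw [hγmin]
    exact lt_min (lt_min hγlo (by positivity)) (lt_min (by positivity) (by positivity))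
  have hγmin_lo : γmin ≤ γlo := hγmin ▸ (min_le_left _ _).trans (min_le_left _ _)
  have hγmin_cauchy : γmin ≤ γc / (1 + κ) := hγmin ▸ (min_le_left _ _).trans (min_le_right _ _)
  have hγmin_ratio : γmin ≤ γc * (1 - η) / (2 * κ) :=
    hγmin ▸ (min_le_right _ _).trans (min_le_left _ _)
  have hγmin_inv : γmin ≤ 1 / (1 + κ) := hγmin_cauchy.trans (by gcongr)
  have hγmin1 : γmin ≤ 1 := hγmin_inv.trans ((div_le_one (by linarith)).2 (by linarith))
  have hcauchy : ∀ k, 0 < γ k →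
      min (γ k) (1 / (1 + κ)) / 2 * ‖g (x k)‖ ^ 2 ≤ m k 0 - m k (s k) := by
    intro k hγk
    obtain ⟨hδ, -, hdec⟩ := halg k
    set t := min (γ k) (1 / (1 + κ))
    have ht0 : 0 ≤ t := le_min hγk.le (by positivity)
    have htκ : t * κ ≤ 1 := by
      have := (le_div_iff₀ (by linarith : 0 < 1 + κ)).1 (min_le_right (γ k) (1 / (1 + κ)))
      linarith
    have htδ : t * ‖g (x k)‖ ≤ δ k := by
      rw [hδ]
      gcongr
      exact min_le_left _ _
    have hle := hdec t ht0 htδ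
    have hmodel := half_mul_norm_sq_le_neg_quadratic (hHnorm (x k)) ht0 htκ (g (x k))
    have hm0 : m k 0 = f (x k) := by simp [hm]
    rw [hm k (-(t • g (x k)))] at hle
    linarith
  have hpred : ∀ k, 0 < γ k → 0 < m k 0 - m k (s k) := fun k hγk ↦ by
    have hgpos : 0 < ‖g (x k)‖ := norm_pos_iff.2 (hgk k)
    have htpos : 0 < min (γ k) (1 / (1 + κ)) := lt_min hγk (by positivity)
    exact lt_of_lt_of_le (by positivity) (hcauchy k hγk)
  have hsmall : ∀ k, 0 < γ k → γ k ≤ 1 / (1 + κ) → γ k ≤ (1 - η) / (2 * κ) → η ≤ ρ k := by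
    intro k hγk hinv hratio
    obtain ⟨hδ, hs, -⟩ := halg k
    have hc := hcauchy k hγk
    rw [min_eq_left hinv] at hc
    have hstep : κ * ‖s k‖ ^ 2 ≤ (1 - η) * (m k 0 - m k (s k)) :=
      calc κ * ‖s k‖ ^ 2 ≤ κ * (γ k * ‖g (x k)‖) ^ 2 := by
            gcongr
            exact hs.trans_eq hδ
        _ = γ k * (2 * κ) * (γ k / 2 * ‖g (x k)‖ ^ 2) := by ring
        _ ≤ (1 - η) * (γ k / 2 * ‖g (x k)‖ ^ 2) := by
            gcongr
            exact (le_div_iff₀ (by positivity)).1 hratio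
        _ ≤ (1 - η) * (m k 0 - m k (s k)) := by gcongr
    have hup := image_add_le_of_norm_hessian_le hg hH hHnorm (x k) (s k)
    have hlow := (abs_le.1 (inner_clm_self_le_of_norm_le (hHnorm (x k)) (s k))).1
    have hm0 : m k 0 = f (x k) := by simp [hm]
    rw [hρ, le_div_iff₀ (hpred k hγk)]
    linarith [hm k (s k)]
  have hγ : ∀ k, γmin ≤ γ k := by
    intro k
    induction k with
    | zero => exact hγmin_lo.trans hγ0.1
    | succ k ih =>
      have hγk : 0 < γ k := hγmin0.trans_le ih
      rcases le_or_gt η (ρ k) with h | h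
      · exact hγmin_lo.trans (hsucc k h).2.1
      · rw [(hfail k h).2]
        by_cases hinv : γ k ≤ 1 / (1 + κ)
        · have hratio : (1 - η) / (2 * κ) < γ k := by
            by_contra! hratio
            exact h.not_ge (hsmall k hγk hinv hratio)
          calc γmin ≤ γc * ((1 - η) / (2 * κ)) := by rwa [← mul_div_assoc]
            _ ≤ γc * γ k := by gcongr
        · calc γmin ≤ γc * (1 / (1 + κ)) := by rwa [mul_one_div]
            _ ≤ γc * γ k := by gcongr; exact (not_le.1 hinv).le
  have hdecrease : ∀ k, η ≤ ρ k → f (x (k + 1)) + η * (m k 0 - m k (s k)) ≤ f (x k) := by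
    intro k hk
    rw [(hsucc k hk).1]
    rw [hρ, le_div_iff₀ (hpred k (hγmin0.trans_le (hγ k)))] at hk
    linarith
  have hmono : ∀ k, f (x (k + 1)) ≤ f (x k) := by
    intro k
    rcases le_or_gt η (ρ k) with h | h
    · have := mul_pos hη0 (hpred k (hγmin0.trans_le (hγ k)))
      linarith [hdecrease k h]
    · rw [(hfail k h).1]
  refine finite_and_ncard_le_floor_of_decrease (a := fun k ↦ f (x k)) (by rw [hκmin]; positivity)
    (fun k ↦ hfinf (x k)) hmono ?_
  rintro k ⟨hk, hεk⟩
  have hγk : 0 < γ k := hγmin0.trans_le (hγ k)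
  have hbound : κmin * ε ^ 2 ≤ η * (m k 0 - m k (s k)) :=
    calc κmin * ε ^ 2 = η * (γmin * γmin / 2 * ε ^ 2) := by rw [hκmin]; ring
      _ ≤ η * (min (γ k) (1 / (1 + κ)) / 2 * ‖g (x k)‖ ^ 2) := by
        gcongr
        exact (mul_le_of_le_one_left hγmin0.le hγmin1).trans (le_min (hγ k) hγmin_inv)
      _ ≤ η * (m k 0 - m k (s k)) := by
        gcongr
        exact hcauchy k hγk
  linarith [hdecrease k hk]
end

section
/- Consider the trust region algorithm under the standing assumptions with Update 2, i.e., δ_k = γ_k‖g_k‖ (with Cauchy condition along −g_k) whenever ‖g_k‖² ≥ |(λ_k)₋|³, and δ_k = γ_k|(λ_k)₋| (with Cauchy condition along the eigenvector u_k) whenever ‖g_k‖² < |(λ_k)₋|³; assume that at every iteration either g_k ≠ 0 or λ_k < 0. Set γ_min := min{γ̲, γ_c/(1+κ), γ_c(1−η)/(2κ), 3γ_c(1−η)/L} and κ_min := ½ η γ_min². Then for any ε_g > 0 and ε_H > 0, the set S₂(ε_g, ε_H) := {k ∈ S : ‖g_k‖ > ε_g or |(λ_k)₋| > ε_H} is finite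 and its cardinality satisfies |S₂(ε_g, ε_H)| ≤ ⌊((f(x₀) − f_inf)/κ_min) · max{ε_g⁻², ε_H⁻³}⌋. -/
open scoped RealInnerProductSpace

theorem le_taylor_two_of_deriv_two_le_affine {φ φ' φ'' : ℝ → ℝ} {a b : ℝ}
    (h1 : ∀ t, HasDerivAt φ (φ' t) t) (h2 : ∀ t, HasDerivAt φ' (φ'' t) t)
    (hle : ∀ t, 0 ≤ t → φ'' t ≤ a + b * t) :
    φ 1 ≤ φ 0 + φ' 0 + a / 2 + b / 6 := by
  have h_first : ∀ t, 0 ≤ t → φ' t ≤ φ' 0 + a * t + b / 2 * t ^ 2 := by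
    have hd : ∀ t, HasDerivAt (fun t => a * t + b / 2 * t ^ 2 - φ' t) (a + b * t - φ'' t) t := by
      intro t
      refine (((hasDerivAt_id' t).const_mul a |>.add
        ((hasDerivAt_pow 2 t).const_mul (b / 2))).sub (h2 t)).congr_deriv ?_
      push_cast; ring
    have hm : MonotoneOn (fun t => a * t + b / 2 * t ^ 2 - φ' t) (Set.Ici 0) := by
      apply monotoneOn_of_hasDerivWithinAt_nonneg (convex_Ici 0)
        (fun t _ => (hd t).continuousAt.continuousWithinAt)
        (fun t _ => (hd t).hasDerivWithinAt)
      intro t ht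
      rw [interior_Ici] at ht
      linarith [hle t (le_of_lt ht)]
    intro t ht
    have := hm (Set.mem_Ici.2 le_rfl) (Set.mem_Ici.2 ht) ht
    simp only at this
    linarith
  have hd : ∀ t, HasDerivAt (fun t => φ' 0 * t + a / 2 * t ^ 2 + b / 6 * t ^ 3 - φ t)
      (φ' 0 + a * t + b / 2 * t ^ 2 - φ' t) t := by
    intro t
    refine ((((hasDerivAt_id' t).const_mul (φ' 0) |>.add
      ((hasDerivAt_pow 2 t).const_mul (a / 2))).add
      ((hasDerivAt_pow 3 t).const_mul (b / 6))).sub (h1 t)).congr_deriv ?_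
    push_cast; ring
  have hm : MonotoneOn (fun t => φ' 0 * t + a / 2 * t ^ 2 + b / 6 * t ^ 3 - φ t) (Set.Ici 0) := by
    apply monotoneOn_of_hasDerivWithinAt_nonneg (convex_Ici 0)
      (fun t _ => (hd t).continuousAt.continuousWithinAt)
      (fun t _ => (hd t).hasDerivWithinAt)
    intro t ht
    rw [interior_Ici] at ht
    linarith [h_first t (le_of_lt ht)]
  have := hm (Set.mem_Ici.2 le_rfl) (Set.mem_Ici.2 zero_le_one) zero_le_one
  simp only at this
  linarith

section Taylor

variable {E : Type*} [NormedAddCommGroup E] [InnerProductSpace ℝ E]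

theorem le_quadratic_model_add_of_inner_hessian_le [CompleteSpace E] {f : E → ℝ}
    {g : E → E} {H : E → E →L[ℝ] E}
    (hg : ∀ y, HasGradientAt f (g y) y) (hH : ∀ y, HasFDerivAt g (H y) y) (x s : E) {c b : ℝ}
    (hle : ∀ t : ℝ, 0 ≤ t → ⟪s, (H (x + t • s) - H x) s⟫ ≤ c + b * t) :
    f (x + s) ≤ f x + ⟪g x, s⟫ + (1 / 2) * ⟪s, H x s⟫ + (c / 2 + b / 6) := by
  have hline : ∀ t : ℝ, HasDerivAt (fun t : ℝ => x + t • s) s t := by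
    intro t
    simpa using ((hasDerivAt_id' t).smul_const s).const_add x
  have h1 : ∀ t : ℝ, HasDerivAt (fun t : ℝ => f (x + t • s)) ⟪g (x + t • s), s⟫ t := by
    intro t
    refine ((hg (x + t • s)).hasFDerivAt.comp_hasDerivAt t (hline t)).congr_deriv ?_
    simp
  have h2 : ∀ t : ℝ, HasDerivAt (fun t : ℝ => ⟪g (x + t • s), s⟫) ⟪s, H (x + t • s) s⟫ t := by
    intro t
    have := ((hH (x + t • s)).comp_hasDerivAt t (hline t)).inner ℝ (hasDerivAt_const t s)
    simpa [real_inner_comm] using this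
  have := le_taylor_two_of_deriv_two_le_affine (a := ⟪s, H x s⟫ + c) (b := b) h1 h2 (by
    intro t ht
    have := hle t ht
    rw [sub_apply, inner_sub_right] at this
    linarith)
  simp only [one_smul, zero_smul, add_zero] at this
  linarith

theorem inner_apply_le_of_norm_le {A : E →L[ℝ] E} {C : ℝ} (hA : ‖A‖ ≤ C) (s : E) :
    ⟪s, A s⟫ ≤ C * ‖s‖ ^ 2 := by
  have h1 := real_inner_le_norm s (A s)
  have h2 := A.le_of_opNorm_le hA s
  nlinarith [norm_nonneg s]

theorem le_quadratic_model_add_of_hessian_bounded [CompleteSpace E] {f : E → ℝ}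
    {g : E → E} {H : E → E →L[ℝ] E}
    (hg : ∀ y, HasGradientAt f (g y) y) (hH : ∀ y, HasFDerivAt g (H y) y) {κ : ℝ}
    (hHnorm : ∀ y, ‖H y‖ ≤ κ) (x s : E) :
    f (x + s) ≤ f x + ⟪g x, s⟫ + (1 / 2) * ⟪s, H x s⟫ + κ * ‖s‖ ^ 2 := by
  have := le_quadratic_model_add_of_inner_hessian_le hg hH x s
    (c := 2 * κ * ‖s‖ ^ 2) (b := 0) (fun t _ => by
      have hA : ‖H (x + t • s) - H x‖ ≤ 2 * κ :=
        (norm_sub_le _ _).trans (by linarith [hHnorm (x + t • s), hHnorm x])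
      linarith [inner_apply_le_of_norm_le hA s])
  linarith

theorem le_quadratic_model_add_of_hessian_lipschitz [CompleteSpace E] {f : E → ℝ}
    {g : E → E} {H : E → E →L[ℝ] E} (hg : ∀ y, HasGradientAt f (g y) y) (hH : ∀ y, HasFDerivAt g (H y) y)
    {L : ℝ} (hLip : ∀ y z, ‖H y - H z‖ ≤ L * ‖y - z‖) (x s : E) :
    f (x + s) ≤ f x + ⟪g x, s⟫ + (1 / 2) * ⟪s, H x s⟫ + L / 6 * ‖s‖ ^ 3 := by
  have := le_quadratic_model_add_of_inner_hessian_le hg hH x s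
    (c := 0) (b := L * ‖s‖ ^ 3) (fun t ht => by
      have hA : ‖H (x + t • s) - H x‖ ≤ L * (t * ‖s‖) := by
        simpa [norm_smul, abs_of_nonneg ht] using hLip (x + t • s) x
      linarith [inner_apply_le_of_norm_le hA s])
  linarith

theorem cauchy_decrease_gradient {A : E →L[ℝ] E} {κ : ℝ} (hA : ‖A‖ ≤ κ) (v : E) {t : ℝ}
    (ht : 0 ≤ t) (htκ : t * κ ≤ 1) :
    ⟪v, -(t • v)⟫ + (1 / 2) * ⟪-(t • v), A (-(t • v))⟫ ≤ -(1 / 2) * t * ‖v‖ ^ 2 := by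
  have h := inner_apply_le_of_norm_le hA v
  simp only [map_neg, map_smul, inner_neg_left, inner_neg_right, real_inner_smul_left,
    real_inner_smul_right, real_inner_self_eq_norm_sq, neg_neg]
  have h1 : t * (t * ⟪v, A v⟫) ≤ t * (t * (κ * ‖v‖ ^ 2)) := by gcongr
  have h2 : t * κ * (t * ‖v‖ ^ 2) ≤ 1 * (t * ‖v‖ ^ 2) := by gcongr
  linarith

theorem cauchy_decrease_eigenvector {A : E →L[ℝ] E} {v u : E} {lam t : ℝ} (hu : ‖u‖ = 1)
    (hAu : A u = lam • u) (hvu : ⟪v, u⟫ ≤ 0) (ht : 0 ≤ t) :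
    ⟪v, t • u⟫ + (1 / 2) * ⟪t • u, A (t • u)⟫ ≤ (1 / 2) * lam * t ^ 2 := by
  simp only [map_smul, hAu, real_inner_smul_left, real_inner_smul_right,
    real_inner_self_eq_norm_sq, hu]
  nlinarith [mul_nonneg ht (neg_nonneg.2 hvu)]

end Taylor

theorem finite_and_ncard_mul_le_of_decrease {a : ℕ → ℝ} {b c : ℝ} {S : Set ℕ}
    (ha : Antitone a) (hb : ∀ k, b ≤ a k) (hc : 0 < c)
    (hS : ∀ k ∈ S, c ≤ a k - a (k + 1)) :
    S.Finite ∧ S.ncard * c ≤ a 0 - b := by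
  have key : ∀ T : Finset ℕ, (T : Set ℕ) ⊆ S → T.card * c ≤ a 0 - b := by
    intro T hT
    obtain ⟨N, hN⟩ := T.exists_nat_subset_range
    calc T.card * c = ∑ _k ∈ T, c := by simp
      _ ≤ ∑ k ∈ T, (a k - a (k + 1)) := Finset.sum_le_sum fun k hk => hS k (hT hk)
      _ ≤ ∑ k ∈ Finset.range N, (a k - a (k + 1)) :=
        Finset.sum_le_sum_of_subset_of_nonneg hN
          fun k _ _ => sub_nonneg.2 (ha (Nat.le_succ k))
      _ = a 0 - a N := Finset.sum_range_sub' a N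
      _ ≤ a 0 - b := by linarith [hb N]
  have hfin : S.Finite := by
    by_contra hinf
    obtain ⟨M, hM⟩ := exists_nat_gt ((a 0 - b) / c)
    obtain ⟨T, hTS, hTM⟩ := Set.Infinite.exists_subset_card_eq hinf M
    have := key T hTS
    rw [hTM] at this
    rw [div_lt_iff₀ hc] at hM
    linarith
  refine ⟨hfin, ?_⟩
  rw [Set.ncard_eq_toFinset_card S hfin]
  exact key _ (by simp)

theorem ratio_ge_of_model_error_le {η D err d : ℝ} (hη : η < 1) {p q r : ℝ} (hD : 0 < D)
    (hDd : D ≤ p - q) (hq : r ≤ q + err) (herr : err ≤ (1 - η) * D) (hd : d = (p - r) / (p - q)) :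
    η ≤ d := by
  have hpq : 0 < p - q := hD.trans_le hDd
  rw [hd, le_div_iff₀ hpq]
  nlinarith [mul_le_mul_of_nonneg_left hDd (sub_nonneg.2 hη.le)]

/-- Lemma 7 of the paper: under Update 2, the number of successful iterations
with `‖g_k‖ > ε_g` or `|(λ_k)₋| > ε_H` is at most
`⌊((f(x₀) − f_inf)/κ_min) · max{ε_g⁻², ε_H⁻³}⌋`. -/
theorem successful_iterations_bound_second_order
    (n : ℕ) (hn : 1 ≤ n)
    (f : EuclideanSpace ℝ (Fin n) → ℝ)
    (g : EuclideanSpace ℝ (Fin n) → EuclideanSpace ℝ (Fin n))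
    (H : EuclideanSpace ℝ (Fin n) → EuclideanSpace ℝ (Fin n) →L[ℝ] EuclideanSpace ℝ (Fin n))
    (hf : ContDiff ℝ 2 f)
    (hg : ∀ y, HasGradientAt f (g y) y)
    (hH : ∀ y, HasFDerivAt g (H y) y)
    (finf : ℝ) (hfinf : ∀ y, finf ≤ f y)
    (L : ℝ) (hL : 0 < L)
    (hLip : ∀ y z : EuclideanSpace ℝ (Fin n), ‖H y - H z‖ ≤ L * ‖y - z‖)
    (κ : ℝ) (hκ : 0 < κ) (hHnorm : ∀ y, ‖H y‖ ≤ κ)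
    (γc η γlo γhi : ℝ)
    (hγc : γc ∈ Set.Ioo (0:ℝ) 1) (hη : η ∈ Set.Ioo (0:ℝ) 1)
    (hγlo : 0 < γlo) (hγlohi : γlo ≤ γhi)
    (x : ℕ → EuclideanSpace ℝ (Fin n)) (γ δ : ℕ → ℝ) (s : ℕ → EuclideanSpace ℝ (Fin n))
    (hγ0 : γ 0 ∈ Set.Icc γlo γhi)
    -- `lam k` is the leftmost eigenvalue of the Hessian at `x k`
    (lam : ℕ → ℝ)
    (hlam : ∀ k, (∃ u : EuclideanSpace ℝ (Fin n), ‖u‖ = 1 ∧ H (x k) u = lam k • u) ∧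
      ∀ v : EuclideanSpace ℝ (Fin n), ‖v‖ = 1 → lam k ≤ ⟪v, H (x k) v⟫)
    (m : ℕ → EuclideanSpace ℝ (Fin n) → ℝ)
    (hm : ∀ k s', m k s' = f (x k) + ⟪g (x k), s'⟫ + (1/2) * ⟪s', H (x k) s'⟫)
    -- at every iteration the current point is not second-order stationary
    (hns : ∀ k : ℕ, g (x k) ≠ 0 ∨ lam k < 0)
    -- Update 2: case `K_g` when `‖g_k‖² ≥ |(λ_k)₋|³`, case `K_H` otherwise
    (halg : ∀ k : ℕ,
      (|min 0 (lam k)|^3 ≤ ‖g (x k)‖^2 →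
        δ k = γ k * ‖g (x k)‖ ∧ ‖s k‖ ≤ δ k ∧
        ∀ t : ℝ, 0 ≤ t → t * ‖g (x k)‖ ≤ δ k → m k (s k) ≤ m k (-(t • g (x k)))) ∧
      (‖g (x k)‖^2 < |min 0 (lam k)|^3 →
        lam k < 0 ∧ δ k = γ k * |min 0 (lam k)| ∧ ‖s k‖ ≤ δ k ∧
        ∃ u : EuclideanSpace ℝ (Fin n), ‖u‖ = 1 ∧ H (x k) u = lam k • u ∧ ⟪g (x k), u⟫ ≤ 0 ∧
          ∀ t : ℝ, 0 ≤ t → t ≤ δ k → m k (s k) ≤ m k (t • u)))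
    (ρ : ℕ → ℝ)
    (hρ : ∀ k, ρ k = (f (x k) - f (x k + s k)) / (m k 0 - m k (s k)))
    (hsucc : ∀ k, η ≤ ρ k → x (k+1) = x k + s k ∧ γ (k+1) ∈ Set.Icc γlo γhi)
    (hfail : ∀ k, ρ k < η → x (k+1) = x k ∧ γ (k+1) = γc * γ k)
    (γmin κmin : ℝ)
    (hγmin : γmin = min (min γlo (γc / (1 + κ))) (min (γc * (1 - η) / (2 * κ)) (3 * γc * (1 - η) / L)))
    (hκmin : κmin = (1/2) * η * γmin^2) :
    ∀ εg εH : ℝ, 0 < εg → 0 < εH →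
      {k : ℕ | η ≤ ρ k ∧ (εg < ‖g (x k)‖ ∨ εH < |min 0 (lam k)|)}.Finite ∧
      {k : ℕ | η ≤ ρ k ∧ (εg < ‖g (x k)‖ ∨ εH < |min 0 (lam k)|)}.ncard ≤
        ⌊((f (x 0) - finf) / κmin) * max (εg^2)⁻¹ (εH^3)⁻¹⌋₊ := by
  obtain ⟨hγc0, hγc1⟩ := hγc
  obtain ⟨hη0, hη1⟩ := hη
  have h1η : 0 < 1 - η := sub_pos.2 hη1
  have hγmin0 : 0 < γmin := by
    rw [hγmin]
    refine lt_min (lt_min hγlo (by positivity)) (lt_min (by positivity) (by positivity))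
  have hmin_lo : γmin ≤ γlo := hγmin ▸ (min_le_left _ _).trans (min_le_left _ _)
  have hmin_κ : γmin ≤ γc * (1 / (1 + κ)) := by
    rw [mul_one_div]
    exact hγmin ▸ (min_le_left _ _).trans (min_le_right _ _)
  have hmin_κη : γmin ≤ γc * ((1 - η) / (2 * κ)) := by
    rw [← mul_div_assoc]
    exact hγmin ▸ (min_le_right _ _).trans (min_le_left _ _)
  have hmin_L : γmin ≤ γc * (3 * (1 - η) / L) := by
    have : γc * (3 * (1 - η) / L) = 3 * γc * (1 - η) / L := by ring
    rw [this]
    exact hγmin ▸ (min_le_right _ _).trans (min_le_right _ _)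
  have hmin_mul : γmin * (1 + κ) ≤ 1 := by
    rw [← le_div_iff₀ (by positivity)]
    exact hmin_κ.trans (mul_le_of_le_one_left (by positivity) hγc1.le)
  have hmin_one : γmin ≤ 1 := by nlinarith
  have hmodel : ∀ k v, m k v - m k 0 = ⟪g (x k), v⟫ + (1 / 2) * ⟪v, H (x k) v⟫ := by
    intro k v
    simp only [hm, map_zero, inner_zero_right]
    ring
  have hm0 : ∀ k, m k 0 = f (x k) := by
    intro k
    simp [hm]
  have habs : ∀ k, lam k < 0 → |min 0 (lam k)| = -lam k := by
    intro k hk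
    rw [min_eq_right hk.le, abs_of_neg hk]
  have hgpos : ∀ k, |min 0 (lam k)| ^ 3 ≤ ‖g (x k)‖ ^ 2 → 0 < ‖g (x k)‖ := by
    intro k hk
    rcases hns k with h | h
    · exact norm_pos_iff.2 h
    · by_contra h0
      have hz : ‖g (x k)‖ = 0 := le_antisymm (not_lt.1 h0) (norm_nonneg _)
      rw [habs k h, hz] at hk
      have : 0 < (-lam k) ^ 3 := pow_pos (neg_pos.2 h) 3
      norm_num at hk
      linarith
  have hdecG : ∀ k, |min 0 (lam k)| ^ 3 ≤ ‖g (x k)‖ ^ 2 → ∀ t, 0 ≤ t → t ≤ γ k → t * κ ≤ 1 →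
      (1 / 2) * t * ‖g (x k)‖ ^ 2 ≤ m k 0 - m k (s k) := by
    intro k hk t ht htγ htκ
    obtain ⟨hδ, -, hC⟩ := (halg k).1 hk
    have h1 := hC t ht (by rw [hδ]; gcongr)
    have h2 := hmodel k (-(t • g (x k)))
    linarith [cauchy_decrease_gradient (hHnorm (x k)) (g (x k)) ht htκ]
  have hdecH : ∀ k, 0 < γ k → ‖g (x k)‖ ^ 2 < |min 0 (lam k)| ^ 3 →
      (1 / 2) * γ k ^ 2 * |min 0 (lam k)| ^ 3 ≤ m k 0 - m k (s k) := by
    intro k hγk hk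
    obtain ⟨hneg, hδ, -, u, hu, hHu, hgu, hC⟩ := (halg k).2 hk
    have hδ0 : 0 ≤ δ k := by rw [hδ]; positivity
    have h1 := hC (δ k) hδ0 le_rfl
    have h2 := hmodel k (δ k • u)
    have h3 := cauchy_decrease_eigenvector hu hHu hgu hδ0
    rw [hδ] at h1 h2 h3
    rw [habs k hneg] at h1 h2 h3 ⊢
    linarith
  have hγ_succ_of_small : ∀ k, 0 < γ k → γ k ≤ 1 / (1 + κ) → γ k ≤ (1 - η) / (2 * κ) →
      γ k ≤ 3 * (1 - η) / L → η ≤ ρ k := by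
    intro k hγk hb1 hb2 hb3
    rw [le_div_iff₀ (by positivity)] at hb1 hb2 hb3
    rcases le_or_gt (|min 0 (lam k)| ^ 3) (‖g (x k)‖ ^ 2) with hk | hk
    · have hgk := hgpos k hk
      obtain ⟨hδ, hs, -⟩ := (halg k).1 hk
      have hdec := hdecG k hk (γ k) hγk.le le_rfl (by linarith)
      have hT := le_quadratic_model_add_of_hessian_bounded hg hH hHnorm (x k) (s k)
      rw [← hm] at hT
      have hs2 : κ * ‖s k‖ ^ 2 ≤ κ * (γ k * ‖g (x k)‖) ^ 2 := by
        rw [← hδ]; gcongr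
      refine ratio_ge_of_model_error_le hη1 (by positivity) hdec (hT.trans (by gcongr)) ?_
        (by rw [hρ, hm0])
      have := mul_le_mul_of_nonneg_left hb2 (by positivity : 0 ≤ γ k * ‖g (x k)‖ ^ 2)
      linarith
    · have hl : 0 < |min 0 (lam k)| := by
        rw [habs k ((halg k).2 hk).1]; linarith [((halg k).2 hk).1]
      obtain ⟨-, hδ, hs, -⟩ := (halg k).2 hk
      have hdec := hdecH k hγk hk
      have hT := le_quadratic_model_add_of_hessian_lipschitz hg hH hLip (x k) (s k)
      rw [← hm] at hT
      have hs3 : L / 6 * ‖s k‖ ^ 3 ≤ L / 6 * (γ k * |min 0 (lam k)|) ^ 3 := by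
        rw [← hδ]; gcongr
      refine ratio_ge_of_model_error_le hη1 (by positivity) hdec (hT.trans (by gcongr)) ?_
        (by rw [hρ, hm0])
      have := mul_le_mul_of_nonneg_left hb3
        (by positivity : 0 ≤ γ k ^ 2 * |min 0 (lam k)| ^ 3)
      linarith
  have hγ_lower : ∀ k, γmin ≤ γ k := by
    intro k
    induction k with
    | zero => exact hmin_lo.trans hγ0.1
    | succ k ih =>
      rcases le_or_gt η (ρ k) with hk | hk
      · exact hmin_lo.trans (hsucc k hk).2.1
      · rw [(hfail k hk).2]
        by_contra! hlt
        refine hk.not_ge (hγ_succ_of_small k (hγmin0.trans_le ih) ?_ ?_ ?_)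
        · exact (lt_of_mul_lt_mul_left (hlt.trans_le hmin_κ) hγc0.le).le
        · exact (lt_of_mul_lt_mul_left (hlt.trans_le hmin_κη) hγc0.le).le
        · exact (lt_of_mul_lt_mul_left (hlt.trans_le hmin_L) hγc0.le).le
  have hκmin0 : 0 < κmin := by rw [hκmin]; positivity
  have hdec : ∀ k, η ≤ ρ k →
      κmin * max (‖g (x k)‖ ^ 2) (|min 0 (lam k)| ^ 3) ≤ f (x k) - f (x (k + 1)) := by
    intro k hk
    have hD : (1 / 2) * γmin ^ 2 * max (‖g (x k)‖ ^ 2) (|min 0 (lam k)| ^ 3) ≤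
          m k 0 - m k (s k) ∧ 0 < m k 0 - m k (s k) := by
      rcases le_or_gt (|min 0 (lam k)| ^ 3) (‖g (x k)‖ ^ 2) with h | h
      · rw [max_eq_left h]
        have hgk := hgpos k h
        have h1 := hdecG k h γmin hγmin0.le (hγ_lower k) (by linarith)
        have h2 : γmin ^ 2 ≤ γmin := by nlinarith
        refine ⟨le_trans (by gcongr) h1, lt_of_lt_of_le (by positivity) h1⟩
      · rw [max_eq_right h.le]
        have hpos : 0 < |min 0 (lam k)| ^ 3 := lt_of_le_of_lt (by positivity) h
        have h1 := hdecH k (hγmin0.trans_le (hγ_lower k)) h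
        have h2 := hγ_lower k
        have hle : (1 / 2) * γmin ^ 2 * |min 0 (lam k)| ^ 3 ≤ m k 0 - m k (s k) :=
          le_trans (by gcongr) h1
        exact ⟨hle, lt_of_lt_of_le (by positivity) hle⟩
    obtain ⟨hD, hDpos⟩ := hD
    have hr := hk
    rw [hρ, le_div_iff₀ hDpos] at hr
    rw [(hsucc k hk).1, hκmin]
    linarith [mul_le_mul_of_nonneg_left hD hη0.le]
  have hanti : Antitone (fun k => f (x k)) := by
    refine antitone_nat_of_succ_le fun k => ?_
    rcases le_or_gt η (ρ k) with hk | hk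
    · have : 0 ≤ κmin * max (‖g (x k)‖ ^ 2) (|min 0 (lam k)| ^ 3) := by positivity
      linarith [hdec k hk]
    · rw [(hfail k hk).1]
  intro εg εH hεg hεH
  have hmin0 : 0 < min (εg ^ 2) (εH ^ 3) := by positivity
  obtain ⟨hfin, hcard⟩ := finite_and_ncard_mul_le_of_decrease
    (S := {k : ℕ | η ≤ ρ k ∧ (εg < ‖g (x k)‖ ∨ εH < |min 0 (lam k)|)})
    hanti (fun k => hfinf (x k)) (mul_pos hκmin0 hmin0) (by
      rintro k ⟨hk, hε⟩
      refine le_trans (mul_le_mul_of_nonneg_left ?_ hκmin0.le) (hdec k hk)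
      rcases hε with h | h
      · exact (min_le_left _ _).trans (le_max_of_le_left (by gcongr))
      · exact (min_le_right _ _).trans (le_max_of_le_right (by gcongr)))
  refine ⟨hfin, Nat.le_floor ?_⟩
  have hinv : (min (εg ^ 2) (εH ^ 3))⁻¹ ≤ max (εg ^ 2)⁻¹ (εH ^ 3)⁻¹ := by
    rcases min_choice (εg ^ 2) (εH ^ 3) with h | h <;> rw [h]
    · exact le_max_left _ _
    · exact le_max_right _ _
  have hgap : 0 ≤ (f (x 0) - finf) / κmin := div_nonneg (sub_nonneg.2 (hfinf _)) hκmin0.le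
  refine le_trans ?_ (mul_le_mul_of_nonneg_left hinv hgap)
  rw [← div_eq_mul_inv, div_div]
  exact (le_div_iff₀ (mul_pos hκmin0 hmin0)).2 hcard
end

section
/- Let n ≥ 1 and let f : ℝⁿ → ℝ be twice continuously differentiable with gradient g and Hessian H, where H is Lipschitz continuous with constant L > 0; set β := L/2. Let ε > 0 and δ := √ε/β. Suppose x ∈ ℝⁿ, s ∈ ℝⁿ, and ξ ∈ ℝ satisfy g(x) + (H(x) + ξI)s = 0, ‖s‖ ≤ δ, and 0 ≤ ξ ≤ √ε. Then ‖g(x + s)‖ ≤ 2ε/β. -/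
open scoped RealInnerProductSpace

/-- The first-order Taylor remainder of a map whose derivative is `L`-Lipschitz is at most
`L / 2 * ‖s‖ ^ 2`. -/
theorem norm_taylor_remainder_le_of_lipschitz_fderiv {E F : Type*}
    [NormedAddCommGroup E] [NormedSpace ℝ E] [NormedAddCommGroup F] [NormedSpace ℝ F]
    {g : E → F} {g' : E → E →L[ℝ] F} {L : ℝ} (hg : ∀ y, HasFDerivAt g (g' y) y)
    (hLip : ∀ y z, ‖g' y - g' z‖ ≤ L * ‖y - z‖) (x s : E) :
    ‖g (x + s) - g x - g' x s‖ ≤ L / 2 * ‖s‖ ^ 2 := by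
  have hline (t : ℝ) : HasDerivAt (fun t : ℝ => x + t • s) s t := by
    simpa using ((hasDerivAt_id t).smul_const s).const_add x
  have hrem (t : ℝ) : HasDerivAt (fun t : ℝ => g (x + t • s) - g x - t • g' x s)
      ((g' (x + t • s) - g' x) s) t := by
    simpa using (((hg (x + t • s)).comp_hasDerivAt t (hline t)).sub_const (g x)).fun_sub
      ((hasDerivAt_id t).smul_const (g' x s))
  have hbound (t : ℝ) : HasDerivAt (fun t : ℝ => L / 2 * ‖s‖ ^ 2 * t ^ 2) (L * ‖s‖ ^ 2 * t) t := by
    refine ((hasDerivAt_pow 2 t).const_mul (L / 2 * ‖s‖ ^ 2)).congr_deriv ?_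
    push_cast
    ring
  have key := image_norm_le_of_norm_deriv_right_le_deriv_boundary (a := 0) (b := 1)
    (fun t _ => (hrem t).continuousAt.continuousWithinAt)
    (fun t _ => (hrem t).hasDerivWithinAt) (by simp) hbound
    (fun t ht => by
      calc ‖(g' (x + t • s) - g' x) s‖ ≤ ‖g' (x + t • s) - g' x‖ * ‖s‖ :=
            ContinuousLinearMap.le_opNorm _ _
        _ ≤ L * ‖x + t • s - x‖ * ‖s‖ := by gcongr; exact hLip _ _
        _ = L * ‖s‖ ^ 2 * t := by
            rw [add_sub_cancel_left, norm_smul, Real.norm_of_nonneg ht.1]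
            ring)
    (Set.right_mem_Icc.2 zero_le_one)
  simpa using key

/-- Case 1 of Section 2.5 (gradient bound): if `g(x) + (H(x) + ξI)s = 0` with
`‖s‖ ≤ δ = √ε/β` and `0 ≤ ξ ≤ √ε`, then `‖g(x+s)‖ ≤ 2ε/β`, where `β = L/2`. -/
theorem next_gradient_bound
    (n : ℕ) (hn : 1 ≤ n)
    (f : EuclideanSpace ℝ (Fin n) → ℝ)
    (g : EuclideanSpace ℝ (Fin n) → EuclideanSpace ℝ (Fin n))
    (H : EuclideanSpace ℝ (Fin n) → EuclideanSpace ℝ (Fin n) →L[ℝ] EuclideanSpace ℝ (Fin n))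
    (hf : ContDiff ℝ 2 f)
    (hg : ∀ y, HasGradientAt f (g y) y)
    (hH : ∀ y, HasFDerivAt g (H y) y)
    (L : ℝ) (hL : 0 < L)
    (hLip : ∀ y z : EuclideanSpace ℝ (Fin n), ‖H y - H z‖ ≤ L * ‖y - z‖)
    (β : ℝ) (hβ : β = L / 2)
    (ε : ℝ) (hε : 0 < ε)
    (δ : ℝ) (hδ : δ = Real.sqrt ε / β)
    (x s : EuclideanSpace ℝ (Fin n)) (ξ : ℝ)
    (hstat : g x + H x s + ξ • s = 0)
    (hs : ‖s‖ ≤ δ)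
    (hξ0 : 0 ≤ ξ) (hξ : ξ ≤ Real.sqrt ε) :
    ‖g (x + s)‖ ≤ 2 * ε / β := by
  have hβ0 : 0 < β := by rw [hβ]; positivity
  have htaylor : ‖g (x + s) - g x - H x s‖ ≤ β * ‖s‖ ^ 2 := by
    rw [hβ]
    exact norm_taylor_remainder_le_of_lipschitz_fderiv hH hLip x s
  have hsplit : g (x + s) = (g (x + s) - g x - H x s) - ξ • s := by
    rw [eq_neg_of_add_eq_zero_right hstat]
    abel
  rw [hδ] at hs
  calc ‖g (x + s)‖ ≤ ‖g (x + s) - g x - H x s‖ + ‖ξ • s‖ := by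
        conv_lhs => rw [hsplit]
        exact norm_sub_le _ _
    _ ≤ β * ‖s‖ ^ 2 + ξ * ‖s‖ := by
        rw [norm_smul, Real.norm_of_nonneg hξ0]
        gcongr
    _ ≤ β * (√ε / β) ^ 2 + √ε * (√ε / β) := by gcongr
    _ = 2 * √ε ^ 2 / β := by field_simp; ring
    _ = 2 * ε / β := by rw [Real.sq_sqrt hε.le]
end

section
/- Let n ≥ 1 and let f : ℝⁿ → ℝ be twice continuously differentiable with Hessian H, where H is Lipschitz continuous with constant L > 0; set β := L/2. Let ε > 0 and δ := √ε/β. Suppose x ∈ ℝⁿ, s ∈ ℝⁿ, and ξ ∈ ℝ satisfy H(x) + ξI ⪰ 0 (i.e., vᵀ(H(x) + ξI)v ≥ 0 for all v), ‖s‖ ≤ δ, and 0 ≤ ξ ≤ √ε. Then the leftmost eigenvalue λ(x+s) of H(x+s) satisfies λ(x+s) ≥ −3√ε. -/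
open scoped RealInnerProductSpace

/-- Perturbing an operator changes its Rayleigh quotient at a unit vector by at most the operator
norm of the perturbation. -/
theorem rayleigh_sub_norm_le {E : Type*} [NormedAddCommGroup E] [InnerProductSpace ℝ E]
    (A B : E →L[ℝ] E) {u : E} (hu : ‖u‖ = 1) :
    ⟪u, A u⟫ - ‖B - A‖ ≤ ⟪u, B u⟫ := by
  have h : |⟪u, (B - A) u⟫| ≤ ‖B - A‖ := by
    calc |⟪u, (B - A) u⟫| ≤ ‖u‖ * ‖(B - A) u‖ := abs_real_inner_le_norm _ _
      _ ≤ ‖u‖ * (‖B - A‖ * ‖u‖) := by gcongr; exact (B - A).le_opNorm u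
      _ = ‖B - A‖ := by rw [hu]; ring
  rw [sub_apply, inner_sub_right] at h
  linarith [(abs_le.mp h).1]

/-- Case 1 of Section 2.5 (eigenvalue bound): if `H(x) + ξI ⪰ 0` with
`‖s‖ ≤ δ = √ε/β` and `0 ≤ ξ ≤ √ε`, then the leftmost eigenvalue of `H(x+s)`
is at least `−3√ε`, where `β = L/2`. -/
theorem next_eigenvalue_bound
    (n : ℕ) (hn : 1 ≤ n)
    (f : EuclideanSpace ℝ (Fin n) → ℝ)
    (g : EuclideanSpace ℝ (Fin n) → EuclideanSpace ℝ (Fin n))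
    (H : EuclideanSpace ℝ (Fin n) → EuclideanSpace ℝ (Fin n) →L[ℝ] EuclideanSpace ℝ (Fin n))
    (hf : ContDiff ℝ 2 f)
    (hg : ∀ y, HasGradientAt f (g y) y)
    (hH : ∀ y, HasFDerivAt g (H y) y)
    (L : ℝ) (hL : 0 < L)
    (hLip : ∀ y z : EuclideanSpace ℝ (Fin n), ‖H y - H z‖ ≤ L * ‖y - z‖)
    (β : ℝ) (hβ : β = L / 2)
    (ε : ℝ) (hε : 0 < ε)
    (δ : ℝ) (hδ : δ = Real.sqrt ε / β)
    (x s : EuclideanSpace ℝ (Fin n)) (ξ : ℝ)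
    (hpsd : ∀ v : EuclideanSpace ℝ (Fin n), 0 ≤ ⟪v, H x v⟫ + ξ * ‖v‖^2)
    (hs : ‖s‖ ≤ δ)
    (hξ0 : 0 ≤ ξ) (hξ : ξ ≤ Real.sqrt ε)
    -- `lam` is the leftmost eigenvalue of `H (x + s)`
    (lam : ℝ)
    (heig : ∃ u : EuclideanSpace ℝ (Fin n), ‖u‖ = 1 ∧ H (x + s) u = lam • u)
    (hleft : ∀ v : EuclideanSpace ℝ (Fin n), ‖v‖ = 1 → lam ≤ ⟪v, H (x + s) v⟫) :
    lam ≥ -3 * Real.sqrt ε := by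
  obtain ⟨u, hu, hHu⟩ := heig
  have hlam : ⟪u, H (x + s) u⟫ = lam := by
    rw [hHu, real_inner_smul_right, real_inner_self_eq_norm_sq, hu]; ring
  have hpert := rayleigh_sub_norm_le (H x) (H (x + s)) hu
  have hcurv := hpsd u
  have hdiff := hLip (x + s) x
  rw [add_sub_cancel_left] at hdiff
  have hstep : L * ‖s‖ ≤ 2 * Real.sqrt ε := by
    calc L * ‖s‖ ≤ L * δ := by gcongr
      _ = 2 * Real.sqrt ε := by rw [hδ, hβ]; field_simp
  rw [hu] at hcurv
  linarith
end

section
/- Let n ≥ 1 and let f : ℝⁿ → ℝ be twice continuously differentiable with gradient g and Hessian H, where H is Lipschitz continuous with constant L > 0; set β := L/2. Let ε > 0 and δ := √ε/β. Suppose x ∈ ℝⁿ, s ∈ ℝⁿ, and ξ ∈ ℝ satisfy g(x) + (H(x) + ξI)s = 0, H(x) + ξI ⪰ 0, ‖s‖ = δ, and ξ > √ε. Then f(x + s) − f(x) ≤ −ε^{3/2}/(6β²). -/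
open scoped RealInnerProductSpace

theorem le_apply_zero_of_hasDerivAt_nonpos_s14 {φ φ' : ℝ → ℝ}
    (hφ : ∀ t, HasDerivAt φ (φ' t) t) (hφ' : ∀ t, 0 ≤ t → φ' t ≤ 0) {t : ℝ} (ht : 0 ≤ t) :
    φ t ≤ φ 0 := by
  refine antitoneOn_of_deriv_nonpos (convex_Ici 0)
    (fun u _ => (hφ u).continuousAt.continuousWithinAt)
    (fun u _ => (hφ u).differentiableAt.differentiableWithinAt) (fun u hu => ?_)
    Set.self_mem_Ici ht ht
  rw [(hφ u).deriv]
  exact hφ' u (interior_subset hu)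

/-- The cubic overestimation bound for a function with Lipschitz continuous Hessian. -/
theorem sub_le_inner_add_cubic_of_lipschitz_hessian {E : Type*} [NormedAddCommGroup E]
    [InnerProductSpace ℝ E] [CompleteSpace E] {f : E → ℝ} {g : E → E} {H : E → E →L[ℝ] E}
    (hg : ∀ y, HasGradientAt f (g y) y) (hH : ∀ y, HasFDerivAt g (H y) y) {L : ℝ}
    (hLip : ∀ y z, ‖H y - H z‖ ≤ L * ‖y - z‖) (x s : E) :
    f (x + s) - f x ≤ ⟪g x, s⟫ + ⟪H x s, s⟫ / 2 + L / 6 * ‖s‖ ^ 3 := by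
  have hline (t : ℝ) : HasDerivAt (fun t : ℝ => x + t • s) s t := by
    simpa using ((hasDerivAt_id t).smul_const s).const_add x
  have hf (t : ℝ) : HasDerivAt (fun t : ℝ => f (x + t • s)) ⟪g (x + t • s), s⟫ t := by
    simpa [Function.comp_def] using (hg (x + t • s)).hasFDerivAt.comp_hasDerivAt t (hline t)
  have hgs (t : ℝ) : HasDerivAt (fun t : ℝ => ⟪g (x + t • s), s⟫) ⟪H (x + t • s) s, s⟫ t := by
    simpa using ((hH (x + t • s)).comp_hasDerivAt t (hline t)).inner ℝ (hasDerivAt_const t s)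
  have hcurv (t : ℝ) (ht : 0 ≤ t) :
      ⟪H (x + t • s) s, s⟫ - ⟪H x s, s⟫ - L * t * ‖s‖ ^ 3 ≤ 0 := by
    rw [← inner_sub_left, ← sub_apply, sub_nonpos]
    calc ⟪(H (x + t • s) - H x) s, s⟫ ≤ ‖(H (x + t • s) - H x) s‖ * ‖s‖ := real_inner_le_norm _ _
      _ ≤ (L * ‖x + t • s - x‖ * ‖s‖) * ‖s‖ := by
        gcongr
        exact (ContinuousLinearMap.le_opNorm _ _).trans (by gcongr; exact hLip _ _)
      _ = L * t * ‖s‖ ^ 3 := by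
        rw [add_sub_cancel_left, norm_smul, Real.norm_of_nonneg ht]; ring
  have hslope (t : ℝ) (ht : 0 ≤ t) :
      ⟪g (x + t • s), s⟫ - ⟪g x, s⟫ - t * ⟪H x s, s⟫ - L / 2 * t ^ 2 * ‖s‖ ^ 3 ≤ 0 := by
    have hderiv (u : ℝ) : HasDerivAt
        (fun u : ℝ => ⟪g (x + u • s), s⟫ - u * ⟪H x s, s⟫ - L / 2 * u ^ 2 * ‖s‖ ^ 3)
        (⟪H (x + u • s) s, s⟫ - ⟪H x s, s⟫ - L * u * ‖s‖ ^ 3) u := by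
      refine (((hgs u).sub ((hasDerivAt_id u).mul_const ⟪H x s, s⟫)).sub
        (((hasDerivAt_pow 2 u).const_mul (L / 2)).mul_const (‖s‖ ^ 3))).congr_deriv ?_
      push_cast
      ring
    have := le_apply_zero_of_hasDerivAt_nonpos_s14 hderiv hcurv ht
    norm_num at this
    linarith
  have hderiv (u : ℝ) : HasDerivAt
      (fun u : ℝ => f (x + u • s) - u * ⟪g x, s⟫ - u ^ 2 * (⟪H x s, s⟫ / 2)
        - L / 6 * u ^ 3 * ‖s‖ ^ 3)
      (⟪g (x + u • s), s⟫ - ⟪g x, s⟫ - u * ⟪H x s, s⟫ - L / 2 * u ^ 2 * ‖s‖ ^ 3) u := by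
    refine ((((hf u).sub ((hasDerivAt_id u).mul_const ⟪g x, s⟫)).sub
      ((hasDerivAt_pow 2 u).mul_const (⟪H x s, s⟫ / 2))).sub
      (((hasDerivAt_pow 3 u).const_mul (L / 6)).mul_const (‖s‖ ^ 3))).congr_deriv ?_
    push_cast
    ring
  have := le_apply_zero_of_hasDerivAt_nonpos_s14 hderiv hslope zero_le_one
  norm_num at this
  linarith

/-- Case 2 of Section 2.5 (objective decrease): if `(s, ξ)` solves the trust
region subproblem exactly with multiplier `ξ > √ε` and `‖s‖ = δ = √ε/β`, then
`f(x+s) − f(x) ≤ −ε^{3/2}/(6β²)`, where `β = L/2`. -/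
theorem objective_decrease_bound
    (n : ℕ) (hn : 1 ≤ n)
    (f : EuclideanSpace ℝ (Fin n) → ℝ)
    (g : EuclideanSpace ℝ (Fin n) → EuclideanSpace ℝ (Fin n))
    (H : EuclideanSpace ℝ (Fin n) → EuclideanSpace ℝ (Fin n) →L[ℝ] EuclideanSpace ℝ (Fin n))
    (hf : ContDiff ℝ 2 f)
    (hg : ∀ y, HasGradientAt f (g y) y)
    (hH : ∀ y, HasFDerivAt g (H y) y)
    (L : ℝ) (hL : 0 < L)
    (hLip : ∀ y z : EuclideanSpace ℝ (Fin n), ‖H y - H z‖ ≤ L * ‖y - z‖)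
    (β : ℝ) (hβ : β = L / 2)
    (ε : ℝ) (hε : 0 < ε)
    (δ : ℝ) (hδ : δ = Real.sqrt ε / β)
    (x s : EuclideanSpace ℝ (Fin n)) (ξ : ℝ)
    (hstat : g x + H x s + ξ • s = 0)
    (hpsd : ∀ v : EuclideanSpace ℝ (Fin n), 0 ≤ ⟪v, H x v⟫ + ξ * ‖v‖^2)
    (hs : ‖s‖ = δ)
    (hξ : Real.sqrt ε < ξ) :
    f (x + s) - f x ≤ -(Real.sqrt ε)^3 / (6 * β^2) := by
  have hbound := sub_le_inner_add_cubic_of_lipschitz_hessian hg hH hLip x s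
  have hβ0 : 0 < β := by linarith
  have hpsd' := hpsd s
  have hinner : ⟪g x, s⟫ + ⟪H x s, s⟫ + ξ * ‖s‖ ^ 2 = 0 := by
    rw [← real_inner_self_eq_norm_sq, ← real_inner_smul_left, ← inner_add_left,
      ← inner_add_left, hstat, inner_zero_left]
  rw [real_inner_comm] at hpsd'
  have hmul : Real.sqrt ε * ‖s‖ ^ 2 ≤ ξ * ‖s‖ ^ 2 := by gcongr
  have hval : -(Real.sqrt ε) ^ 3 / (6 * β ^ 2)
      = -(Real.sqrt ε * ‖s‖ ^ 2) / 2 + L / 6 * ‖s‖ ^ 3 := by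
    rw [hs, hδ, show L = 2 * β by linarith]
    field_simp
    ring
  linarith
end
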